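/- arXiv:math/0609291 — 4 statements merged into one kernel-verified Lean document; each statement's English description precedes it below -/
import Mathlib

section
/- Let C be a semidualizing module over a commutative noetherian ring R. Then the class I_C is enveloping: every R-module has an I_C-envelope. -/
/-!
Common definitions: Ext/Tor vanishing, semidualizing modules, the Auslander and Bass
classes, (pre)covers and (pre)envelopes, cotorsion pairs, the classes `I_C` and `F_C`,
purity, and Kaplansky classes.
-/

open CategoryTheory

universe u

noncomputable section

/-- `Ext^j_R(A,B) = 0`. -/
def extVanishes (R : Type u) [CommRing R] (A B : ModuleCat.{u} R) (j : ℕ) : Prop :=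
  Subsingleton (((Ext R (ModuleCat.{u} R) j).obj (Opposite.op A)).obj B)

/-- `Tor_j^R(A,B) = 0`. -/
def torVanishes (R : Type u) [CommRing R] (A B : ModuleCat.{u} R) (j : ℕ) : Prop :=
  Subsingleton (((Tor (ModuleCat.{u} R) j).obj A).obj B)

/-- A semidualizing module: finitely generated, `Ext^j(C,C) = 0` for all `j > 0`, and the
homothety map `χ_C : R → Hom_R(C,C)`, `r ↦ r • id`, is an isomorphism (bijective). -/
def IsSemidualizing (R : Type u) [CommRing R] (C : Type u) [AddCommGroup C] [Module R C] :
    Prop :=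
  Module.Finite R C ∧
  (∀ j : ℕ, 0 < j → extVanishes R (ModuleCat.of R C) (ModuleCat.of R C) j) ∧
  Function.Bijective (fun r : R => r • (LinearMap.id : C →ₗ[R] C))

/-- The natural map `η_M : M → Hom_R(C, C ⊗_R M)`, `m ↦ (c ↦ c ⊗ m)`. -/
def etaMap (R : Type u) [CommRing R] (C : Type u) [AddCommGroup C] [Module R C]
    (M : Type u) [AddCommGroup M] [Module R M] :
    M →ₗ[R] (C →ₗ[R] TensorProduct R C M) :=
  (TensorProduct.mk R C M).flip

/-- The evaluation map `ε_N : C ⊗_R Hom_R(C,N) → N`, `c ⊗ f ↦ f c`. -/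
def epsMap (R : Type u) [CommRing R] (C : Type u) [AddCommGroup C] [Module R C]
    (N : Type u) [AddCommGroup N] [Module R N] :
    TensorProduct R C (C →ₗ[R] N) →ₗ[R] N :=
  TensorProduct.lift (LinearMap.id (R := R) (M := C →ₗ[R] N)).flip

/-- Membership in the Auslander class `A_C`. -/
def memAuslander (R : Type u) [CommRing R] (C : Type u) [AddCommGroup C] [Module R C]
    (M : ModuleCat.{u} R) : Prop :=
  (∀ j : ℕ, 0 < j → torVanishes R (ModuleCat.of R C) M j) ∧
  (∀ j : ℕ, 0 < j →
    extVanishes R (ModuleCat.of R C) (ModuleCat.of R (TensorProduct R C M)) j) ∧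
  Function.Bijective (etaMap R C M)

/-- Membership in the Bass class `B_C`. -/
def memBass (R : Type u) [CommRing R] (C : Type u) [AddCommGroup C] [Module R C]
    (N : ModuleCat.{u} R) : Prop :=
  (∀ j : ℕ, 0 < j → extVanishes R (ModuleCat.of R C) N j) ∧
  (∀ j : ℕ, 0 < j →
    torVanishes R (ModuleCat.of R C) (ModuleCat.of R (C →ₗ[R] N)) j) ∧
  Function.Bijective (epsMap R C N)

/-- The Auslander class `A_C` as a class of modules. -/
def auslanderClass (R : Type u) [CommRing R] (C : Type u) [AddCommGroup C] [Module R C] :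
    Set (ModuleCat.{u} R) :=
  {M | memAuslander R C M}

/-- The Bass class `B_C` as a class of modules. -/
def bassClass (R : Type u) [CommRing R] (C : Type u) [AddCommGroup C] [Module R C] :
    Set (ModuleCat.{u} R) :=
  {N | memBass R C N}

variable (R : Type u) [CommRing R]

/-- `φ : F → M` is an `𝓕`-precover of `M`. -/
def IsPrecover (𝓕 : Set (ModuleCat.{u} R)) {F M : ModuleCat.{u} R} (φ : F ⟶ M) : Prop :=
  F ∈ 𝓕 ∧ ∀ F' ∈ 𝓕, ∀ φ' : F' ⟶ M, ∃ ψ : F' ⟶ F, ψ ≫ φ = φ'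

/-- `φ : F → M` is an `𝓕`-cover of `M`. -/
def IsCover (𝓕 : Set (ModuleCat.{u} R)) {F M : ModuleCat.{u} R} (φ : F ⟶ M) : Prop :=
  IsPrecover R 𝓕 φ ∧ ∀ f : F ⟶ F, f ≫ φ = φ → IsIso f

/-- `φ : M → F` is an `𝓕`-preenvelope of `M`. -/
def IsPreenvelope (𝓕 : Set (ModuleCat.{u} R)) {M F : ModuleCat.{u} R} (φ : M ⟶ F) : Prop :=
  F ∈ 𝓕 ∧ ∀ F' ∈ 𝓕, ∀ φ' : M ⟶ F', ∃ ψ : F ⟶ F', φ ≫ ψ = φ'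

/-- `φ : M → F` is an `𝓕`-envelope of `M`. -/
def IsEnvelope (𝓕 : Set (ModuleCat.{u} R)) {M F : ModuleCat.{u} R} (φ : M ⟶ F) : Prop :=
  IsPreenvelope R 𝓕 φ ∧ ∀ f : F ⟶ F, φ ≫ f = φ → IsIso f

/-- The class `𝓕` is precovering. -/
def Precovering (𝓕 : Set (ModuleCat.{u} R)) : Prop :=
  ∀ M : ModuleCat.{u} R, ∃ (F : ModuleCat.{u} R) (φ : F ⟶ M), IsPrecover R 𝓕 φ

/-- The class `𝓕` is covering. -/
def Covering (𝓕 : Set (ModuleCat.{u} R)) : Prop :=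
  ∀ M : ModuleCat.{u} R, ∃ (F : ModuleCat.{u} R) (φ : F ⟶ M), IsCover R 𝓕 φ

/-- The class `𝓕` is preenveloping. -/
def Preenveloping (𝓕 : Set (ModuleCat.{u} R)) : Prop :=
  ∀ M : ModuleCat.{u} R, ∃ (F : ModuleCat.{u} R) (φ : M ⟶ F), IsPreenvelope R 𝓕 φ

/-- The class `𝓕` is enveloping. -/
def Enveloping (𝓕 : Set (ModuleCat.{u} R)) : Prop :=
  ∀ M : ModuleCat.{u} R, ∃ (F : ModuleCat.{u} R) (φ : M ⟶ F), IsEnvelope R 𝓕 φ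

/-- `𝓕^⊥ = {N | Ext^1(F,N) = 0 for all F ∈ 𝓕}`. -/
def rightPerp (𝓕 : Set (ModuleCat.{u} R)) : Set (ModuleCat.{u} R) :=
  {N | ∀ F ∈ 𝓕, extVanishes R F N 1}

/-- `^⊥𝓖 = {M | Ext^1(M,G) = 0 for all G ∈ 𝓖}`. -/
def leftPerp (𝓖 : Set (ModuleCat.{u} R)) : Set (ModuleCat.{u} R) :=
  {M | ∀ G ∈ 𝓖, extVanishes R M G 1}

/-- `(𝓕, 𝓖)` is a cotorsion pair. -/
def IsCotorsionPair (𝓕 𝓖 : Set (ModuleCat.{u} R)) : Prop :=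
  rightPerp R 𝓕 = 𝓖 ∧ leftPerp R 𝓖 = 𝓕

/-- `(𝓕, 𝓖)` is a perfect cotorsion pair: a cotorsion pair with `𝓕` covering and
`𝓖` enveloping. -/
def IsPerfectCotorsionPair (𝓕 𝓖 : Set (ModuleCat.{u} R)) : Prop :=
  IsCotorsionPair R 𝓕 𝓖 ∧ Covering R 𝓕 ∧ Enveloping R 𝓖

variable (C : Type u) [AddCommGroup C] [Module R C]

/-- The class `I_C` of modules isomorphic to `Hom_R(C, I)` for an injective module `I`. -/
def memIC (V : ModuleCat.{u} R) : Prop :=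
  ∃ I : ModuleCat.{u} R, Module.Injective R I ∧ Nonempty (V ≃ₗ[R] (C →ₗ[R] I))

/-- The class `F_C` of modules isomorphic to `C ⊗_R F` for a flat module `F`. -/
def memFC (V : ModuleCat.{u} R) : Prop :=
  ∃ F : ModuleCat.{u} R, Module.Flat R F ∧ Nonempty (V ≃ₗ[R] TensorProduct R C F)

/-- A short exact sequence `0 → A → B → D → 0` (given by `f` and `g`) is pure exact:
it is exact and remains exact after applying `P ⊗_R −` for every `R`-module `P`. -/
def IsPureExactSeq {A B D : Type u} [AddCommGroup A] [Module R A] [AddCommGroup B]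
    [Module R B] [AddCommGroup D] [Module R D] (f : A →ₗ[R] B) (g : B →ₗ[R] D) : Prop :=
  Function.Injective f ∧ Function.Exact f g ∧ Function.Surjective g ∧
  ∀ (P : Type u) [AddCommGroup P] [Module R P],
    Function.Injective (LinearMap.lTensor P f) ∧
    Function.Exact (LinearMap.lTensor P f) (LinearMap.lTensor P g) ∧
    Function.Surjective (LinearMap.lTensor P g)

/-- A submodule is pure if tensoring the inclusion with any module keeps it injective. -/
def IsPureSubmodule {E : Type u} [AddCommGroup E] [Module R E] (A : Submodule R E) : Prop :=
  ∀ (P : Type u) [AddCommGroup P] [Module R P],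
    Function.Injective (LinearMap.lTensor P A.subtype)

/-- `𝓕` is a Kaplansky class. -/
def KaplanskyClass (𝓕 : Set (ModuleCat.{u} R)) : Prop :=
  ∃ lam : Cardinal.{u}, ∀ M ∈ 𝓕, ∀ x : M, ∃ M' : Submodule R M,
    x ∈ M' ∧ Cardinal.mk M' ≤ lam ∧
    ModuleCat.of R M' ∈ 𝓕 ∧ ModuleCat.of R (M ⧸ M') ∈ 𝓕

end

open scoped TensorProduct

/-- Every module embeds in an injective module as an essential submodule. -/
theorem exists_injective_hull (R : Type u) [CommRing R]
    (N : Type u) [AddCommGroup N] [Module R N] :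
    ∃ (E : ModuleCat.{u} R) (ι : N →ₗ[R] E), Module.Injective R E ∧ Function.Injective ι ∧
      ∀ x : E, x ≠ 0 → ∃ r : R, r • x ≠ 0 ∧ r • x ∈ LinearMap.range ι := by
  let J : ModuleCat.{u} R := Injective.under (ModuleCat.of R N)
  let j : N →ₗ[R] J := (Injective.ι (ModuleCat.of R N)).hom
  have hj : Function.Injective j :=
    (ModuleCat.mono_iff_injective (Injective.ι (ModuleCat.of R N))).mp inferInstance
  have hJ : Module.Injective R J :=
    (Module.injective_iff_injective_object R J).mpr (inferInstanceAs (Injective J))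
  let P : Set (Submodule R J) :=
    {B | LinearMap.range j ≤ B ∧
      ∀ x ∈ B, x ≠ 0 → ∃ r : R, r • x ≠ 0 ∧ r • x ∈ LinearMap.range j}
  obtain ⟨E, hE⟩ : ∃ E, Maximal (· ∈ P) E := by
    obtain ⟨E, -, hE⟩ := zorn_le_nonempty₀ P (fun c hcP hc B hB ↦ by
      refine ⟨sSup c, ⟨(hcP hB).1.trans (le_sSup hB), fun x hx hx0 ↦ ?_⟩, fun _ ↦ le_sSup⟩
      obtain ⟨D, hD, hxD⟩ :=
        (Submodule.mem_sSup_of_directed ⟨B, hB⟩ hc.directedOn).mp hx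
      exact (hcP hD).2 x hxD hx0) (LinearMap.range j)
      ⟨le_rfl, fun x hx hx0 ↦ ⟨1, by simpa using hx0, by simpa using hx⟩⟩
    exact ⟨E, hE⟩
  obtain ⟨K, hK⟩ : ∃ K, Maximal (· ∈ {K : Submodule R J | Disjoint K E}) K := by
    obtain ⟨K, -, hK⟩ := zorn_le_nonempty₀ {K : Submodule R J | Disjoint K E}
      (fun c hcP hc B hB ↦ by
        refine ⟨sSup c, ?_, fun _ ↦ le_sSup⟩
        refine Submodule.disjoint_def.mpr fun x hx hxE ↦ ?_
        obtain ⟨D, hD, hxD⟩ :=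
          (Submodule.mem_sSup_of_directed ⟨B, hB⟩ hc.directedOn).mp hx
        exact Submodule.disjoint_def.mp (hcP hD) x hxD hxE) ⊥ disjoint_bot_left
    exact ⟨K, hK⟩
  have hKE : ∀ x ∈ K, x ∈ E → x = 0 := Submodule.disjoint_def.mp hK.prop
  have ess : ∀ y : J, y ∉ K → ∃ r : R, r • y ∉ K ∧ ∃ e ∈ E, r • y - e ∈ K := by
    intro y hy
    by_contra! h
    refine hy ?_
    have hd : Disjoint (K ⊔ Submodule.span R {y}) E := by
      refine Submodule.disjoint_def.mpr fun x hx hxE ↦ ?_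
      obtain ⟨k, hk, z, hz, rfl⟩ := Submodule.mem_sup.mp hx
      obtain ⟨r, rfl⟩ := Submodule.mem_span_singleton.mp hz
      by_cases hr : r • y ∈ K
      · exact hKE _ (K.add_mem hk hr) hxE
      · refine absurd ?_ (h r hr _ hxE)
        simpa using hk
    exact hK.le_of_ge hd le_sup_left
      (Submodule.mem_sup_right (Submodule.mem_span_singleton_self y))
  have hinj : Function.Injective (K.mkQ ∘ₗ E.subtype) := by
    refine (injective_iff_map_eq_zero _).mpr fun x hx ↦ ?_
    exact Subtype.ext (hKE _ (by simpa using hx) x.2)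
  obtain ⟨ψ, hψ⟩ := hJ.out _ hinj E.subtype
  have hψE : ∀ e ∈ E, ψ (K.mkQ e) = e := fun e he ↦ hψ ⟨e, he⟩
  have key : ∀ y : J, ψ (K.mkQ y) ≠ 0 →
      ∃ r : R, r • ψ (K.mkQ y) ≠ 0 ∧ r • ψ (K.mkQ y) ∈ E := by
    intro y hy
    obtain ⟨r, hr, e, he, hre⟩ := ess y fun h ↦
      hy (by simp [(Submodule.Quotient.mk_eq_zero K).mpr h])
    have h1 : r • ψ (K.mkQ y) = e := by
      rw [← map_smul, ← map_smul, ← hψE e he]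
      exact congrArg ψ ((Submodule.Quotient.eq K).mpr hre)
    refine ⟨r, fun h0 ↦ hr ?_, h1 ▸ he⟩
    rw [← h1, h0, sub_zero] at hre
    exact hre
  have hrange : LinearMap.range ψ ≤ E := by
    refine hE.le_of_ge ⟨fun x hx ↦ ⟨K.mkQ x, hψE x (hE.prop.1 hx)⟩, ?_⟩
      fun e he ↦ ⟨K.mkQ e, hψE e he⟩
    rintro _ ⟨q, rfl⟩ hx0
    obtain ⟨y, rfl⟩ := K.mkQ_surjective q
    obtain ⟨r, hr0, hr⟩ := key y hx0
    obtain ⟨s, hs0, hs⟩ := hE.prop.2 _ hr hr0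
    exact ⟨s * r, by rwa [mul_smul], by rwa [mul_smul]⟩
  let ρ : J →ₗ[R] E := (ψ ∘ₗ K.mkQ).codRestrict E fun x ↦ hrange ⟨_, rfl⟩
  have hρ : ∀ e : E, ρ e = e := fun e ↦ Subtype.ext (hψE e e.2)
  refine ⟨ModuleCat.of R E, j.codRestrict E fun x ↦ hE.prop.1 ⟨x, rfl⟩, ⟨?_⟩, ?_, ?_⟩
  · intro X Y _ _ _ _ f hf g
    obtain ⟨h, hh⟩ := hJ.out f hf (E.subtype ∘ₗ g)
    exact ⟨ρ ∘ₗ h, fun x ↦ (congrArg ρ (hh x)).trans (hρ (g x))⟩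
  · exact fun x y hxy ↦ hj (congrArg Subtype.val hxy)
  · intro x hx
    obtain ⟨r, hr0, n, hn⟩ := hE.prop.2 x x.2 fun h ↦ hx (Subtype.ext h)
    exact ⟨r, fun h ↦ hr0 (congrArg Subtype.val h), n, Subtype.ext hn⟩

/-- An endomorphism of an injective module fixing an essential submodule is invertible. -/
theorem exists_inverse_of_fixes_essential {R : Type u} [CommRing R]
    {N E : Type u} [AddCommGroup N] [Module R N] [AddCommGroup E] [Module R E]
    [hE : Module.Injective R E] {ι : N →ₗ[R] E}
    (ess : ∀ x : E, x ≠ 0 → ∃ r : R, r • x ≠ 0 ∧ r • x ∈ LinearMap.range ι)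
    {g : E →ₗ[R] E} (hg : ∀ n, g (ι n) = ι n) :
    ∃ p : E →ₗ[R] E, (∀ x, p (g x) = x) ∧ ∀ x, g (p x) = x := by
  have inj : ∀ q : E →ₗ[R] E, (∀ n, q (ι n) = ι n) → Function.Injective q := by
    refine fun q hq ↦ (injective_iff_map_eq_zero q).mpr fun x hx ↦ ?_
    by_contra hx0
    obtain ⟨r, hr0, n, hn⟩ := ess x hx0
    refine hr0 ?_
    rw [← hn, ← hq n, hn, map_smul, hx, smul_zero]
  obtain ⟨p, hp⟩ := hE.out g (inj g hg) LinearMap.id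
  have hp' : ∀ x, p (g x) = x := hp
  refine ⟨p, hp', fun x ↦ inj p (fun n ↦ ?_) (hp' (p x))⟩
  rw [← hg n, hp', hg n]

@[simp]
theorem epsMap_tmul (R : Type u) [CommRing R] (C : Type u) [AddCommGroup C] [Module R C]
    (N : Type u) [AddCommGroup N] [Module R N] (c : C) (f : C →ₗ[R] N) :
    epsMap R C N (c ⊗ₜ f) = f c :=
  rfl

/-- If the homothety map of a finitely generated module `C` is bijective, then the evaluation map
`C ⊗ Hom(C, E) → E` is bijective for every injective module `E`. -/
theorem epsMap_bijective_of_injective (R : Type u) [CommRing R] [IsNoetherianRing R]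
    (C : Type u) [AddCommGroup C] [Module R C] [Module.Finite R C]
    (hC : Function.Bijective (fun r : R => r • (LinearMap.id : C →ₗ[R] C)))
    (E : Type u) [AddCommGroup E] [Module R E] [hE : Module.Injective R E] :
    Function.Bijective (epsMap R C E) := by
  obtain ⟨n, π, hπ⟩ := Module.Finite.exists_fin' R C
  let c : Fin n → C := fun i ↦ π (Pi.single i 1)
  have hπc : ∀ a : Fin n → R, π a = ∑ i, a i • c i := fun a ↦ by
    conv_lhs => rw [← Finset.univ_sum_single a]
    simp [c, ← map_smul, ← Pi.single_smul']
  have hann : ∀ r : R, (∀ i, r • c i = 0) → r = 0 := by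
    intro r hr
    refine hC.1 (LinearMap.ext fun x ↦ ?_)
    obtain ⟨a, rfl⟩ := hπ x
    simp [hπc, hr]
  constructor
  · refine (injective_iff_map_eq_zero _).mpr fun t ht ↦ ?_
    obtain ⟨f, rfl⟩ : ∃ f : Fin n → (C →ₗ[R] E), t = ∑ i, c i ⊗ₜ[R] f i := by
      clear ht
      induction t with
      | zero => exact ⟨0, by simp⟩
      | tmul x f =>
        obtain ⟨a, rfl⟩ := hπ x
        exact ⟨fun i ↦ a i • f, by simp [hπc, TensorProduct.sum_tmul, TensorProduct.smul_tmul]⟩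
      | add s t hs ht =>
        obtain ⟨f, rfl⟩ := hs
        obtain ⟨g, rfl⟩ := ht
        exact ⟨f + g, by simp [TensorProduct.tmul_add, Finset.sum_add_distrib]⟩
    have hf : ∑ i, f i (c i) = 0 := by simpa using ht
    obtain ⟨m, κ, hκ⟩ := Module.Finite.exists_fin' R (LinearMap.ker π)
    let k : Fin m → Fin n → R := fun j ↦ κ (Pi.single j 1)
    have hk : ∀ j, ∑ i, k j i • c i = 0 := fun j ↦ by
      rw [← hπc]
      exact (κ (Pi.single j 1)).2
    let T : (Fin n → C) →ₗ[R] (Fin m → C) :=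
      LinearMap.pi fun j ↦ ∑ i, k j i • LinearMap.proj i
    let F : (Fin n → C) →ₗ[R] E := ∑ i, f i ∘ₗ LinearMap.proj i
    have hTF : LinearMap.ker T ≤ LinearMap.ker F := by
      intro x hx
      have hx' : ∀ j, ∑ i, k j i • x i = 0 := fun j ↦ by
        simpa [T] using congrFun hx j
      let X : (Fin n → R) →ₗ[R] C := Fintype.linearCombination R x
      have hX : LinearMap.ker π ≤ LinearMap.ker X := by
        intro a ha
        obtain ⟨b, hb⟩ := hκ ⟨a, ha⟩
        have hXκ : X ∘ₗ (LinearMap.ker π).subtype ∘ₗ κ = 0 := by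
          ext j
          simpa [X, Fintype.linearCombination_apply] using hx' j
        simpa [hb] using LinearMap.congr_fun hXκ b
      obtain ⟨h, hh⟩ : ∃ h : C →ₗ[R] C, ∀ a, h (π a) = X a :=
        ⟨(LinearMap.ker π).liftQ X hX ∘ₗ (π.quotKerEquivOfSurjective hπ).symm.toLinearMap,
          fun a ↦ by
          rw [LinearMap.comp_apply, LinearEquiv.coe_coe,
            (π.quotKerEquivOfSurjective hπ).symm_apply_eq.mpr
              (π.quotKerEquivOfSurjective_apply_mk hπ a).symm, Submodule.liftQ_apply]⟩
      obtain ⟨r, hr⟩ := hC.2 h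
      have hxr : ∀ i, x i = r • c i := fun i ↦ by
        have := hh (Pi.single i 1)
        rw [← hr] at this
        simpa [X, Fintype.linearCombination_apply_single, eq_comm] using this
      simp [F, hxr, ← Finset.smul_sum, hf]
    obtain ⟨G, hG⟩ : ∃ G : (Fin m → C) →ₗ[R] E, ∀ x, G (T x) = F x := by
      obtain ⟨G, hG⟩ := hE.out ((LinearMap.ker T).liftQ T le_rfl)
        (LinearMap.ker_eq_bot.mp (Submodule.ker_liftQ_eq_bot _ _ _ le_rfl))
        ((LinearMap.ker T).liftQ F hTF)
      exact ⟨G, fun x ↦ hG (Submodule.Quotient.mk x)⟩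
    have hfG : ∀ i, f i = ∑ j, k j i • (G ∘ₗ LinearMap.single R (fun _ ↦ C) j) := by
      intro i
      ext x
      have h1 : F (Pi.single i x) = f i x := by
        simp [F, Pi.single_apply, apply_ite]
      have h2 : T (Pi.single i x) = ∑ j, k j i • Pi.single j x := by
        ext l
        simp [T, Pi.single_apply, smul_ite]
      rw [← h1, ← hG, h2]
      simp
    simp only [hfG, TensorProduct.tmul_sum]
    rw [Finset.sum_comm]
    refine Finset.sum_eq_zero fun j _ ↦ ?_
    simp only [← TensorProduct.smul_tmul, ← TensorProduct.sum_tmul, hk, TensorProduct.zero_tmul]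
  · intro e
    obtain ⟨G, hG⟩ := hE.out (LinearMap.toSpanSingleton R (Fin n → C) c)
      ((injective_iff_map_eq_zero _).mpr fun r hr ↦ hann r fun i ↦ congrFun hr i)
      (LinearMap.toSpanSingleton R E e)
    refine ⟨∑ i, c i ⊗ₜ (G ∘ₗ LinearMap.single R (fun _ ↦ C) i), ?_⟩
    have := hG 1
    simp only [LinearMap.toSpanSingleton_apply, one_smul] at this
    rw [← this]
    simp only [map_sum, epsMap_tmul, LinearMap.comp_apply]
    rw [← map_sum]
    congr 1
    exact Finset.univ_sum_single c

/-- If `C` is a semidualizing module over a commutative noetherian ring `R`, then the class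
`I_C` is enveloping: every `R`-module has an `I_C`-envelope. -/
theorem IC_enveloping
    (R : Type u) [CommRing R] [IsNoetherianRing R]
    (C : Type u) [AddCommGroup C] [Module R C] (hC : IsSemidualizing R C) :
    Enveloping R {V : ModuleCat.{u} R | memIC R C V} := by
  obtain ⟨_, -, hχ⟩ := hC
  intro M
  obtain ⟨E, ι, hE, hι, hess⟩ := exists_injective_hull R (TensorProduct R C M)
  let φ : M →ₗ[R] (C →ₗ[R] E) := ι.compRight R ∘ₗ etaMap R C M
  have hφ : ∀ m c, φ m c = ι (c ⊗ₜ m) := fun _ _ ↦ rfl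
  refine ⟨ModuleCat.of R (C →ₗ[R] E), ModuleCat.ofHom φ,
    ⟨⟨E, hE, ⟨LinearEquiv.refl R _⟩⟩, ?_⟩, ?_⟩
  · rintro V ⟨I, hI, ⟨e⟩⟩ φ'
    let ψ : TensorProduct R C M →ₗ[R] I :=
      TensorProduct.lift (e.toLinearMap ∘ₗ φ'.hom).flip
    obtain ⟨q, hq⟩ := hI.out ι hι ψ
    refine ⟨ModuleCat.ofHom (e.symm.toLinearMap ∘ₗ q.compRight R), ?_⟩
    ext m
    refine e.symm_apply_eq.mpr (LinearMap.ext fun c ↦ ?_)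
    exact hq (c ⊗ₜ m)
  · intro f hf
    have hfφ : ∀ m, f.hom (φ m) = φ m := fun m ↦ congrArg (fun q ↦ q.hom m) hf
    let ε := LinearEquiv.ofBijective _ (epsMap_bijective_of_injective R C hχ E)
    let g : E →ₗ[R] E := epsMap R C E ∘ₗ LinearMap.lTensor C f.hom ∘ₗ ε.symm.toLinearMap
    have hg : ∀ (h : C →ₗ[R] E) (c : C), g (h c) = f.hom h c := by
      intro h c
      have : ε.symm (h c) = c ⊗ₜ h := ε.symm_apply_eq.mpr rfl
      simp [g, this]
    have hgι : ∀ t, g (ι t) = ι t := by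
      intro t
      induction t with
      | zero => simp
      | tmul c m => rw [← hφ, hg, hfφ]
      | add s t hs ht => simp [hs, ht]
    obtain ⟨p, hpg, hgp⟩ := exists_inverse_of_fixes_essential hess hgι
    refine (ConcreteCategory.isIso_iff_bijective f).mpr ⟨fun h h' hh ↦ ?_, fun h ↦ ?_⟩
    · refine LinearMap.ext fun c ↦ ?_
      rw [← hpg (h c), ← hpg (h' c), hg, hg]
      exact congrArg (fun q : C →ₗ[R] E ↦ p (q c)) hh
    · exact ⟨p ∘ₗ h, LinearMap.ext fun c ↦ (hg (p ∘ₗ h) c).symm.trans (hgp (h c))⟩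
end

section
/- Let C be a semidualizing module over a commutative noetherian ring R. Then the class F_C is covering: every R-module has an F_C-cover. -/
/-!
Common definitions: Ext/Tor vanishing, semidualizing modules, the Auslander and Bass
classes, (pre)covers and (pre)envelopes, cotorsion pairs, the classes `I_C` and `F_C`,
purity, and Kaplansky classes.
-/

open CategoryTheory

universe u

open Cardinal in
/-- A subset closed under a family of infinitary operations, of bounded cardinality. -/
theorem exists_closed_set {A ι Q : Type u} (op : A → (ι → Q) → Q) (x : Q) :
    ∃ X : Set Q, x ∈ X ∧ (∀ a d, (∀ i, d i ∈ X) → op a d ∈ X) ∧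
      #X ≤ 2 ^ (max (max #A #ι) ℵ₀) := by
  let β : Option A → Type u := fun o => o.elim PEmpty fun _ => ι
  let ev : WType β → Q := WType.elim Q fun p => match p with
    | ⟨none, _⟩ => x
    | ⟨some a, d⟩ => op a d
  refine ⟨Set.range ev, ⟨WType.mk none PEmpty.elim, rfl⟩, fun a d hd => ?_, ?_⟩
  · choose w hw using hd
    refine ⟨WType.mk (some a) w, ?_⟩
    change op a (fun i => ev (w i)) = _
    simp only [hw]
  · refine mk_range_le.trans (WType.cardinalMk_le_of_le ?_)
    set c := max (max #A #ι) ℵ₀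
    have hc : ℵ₀ ≤ c := le_max_right _ _
    have hA : #A ≤ c := (le_max_left _ _).trans (le_max_left _ _)
    have hι : #ι ≤ c := (le_max_right _ _).trans (le_max_left _ _)
    have hcc : c ≤ 2 ^ c := (cantor c).le
    have hβ : ∀ o, ((2 : Cardinal.{u}) ^ c) ^ #(β o) ≤ 2 ^ c := by
      intro o
      rw [← power_mul]
      refine power_le_power_left two_ne_zero ?_
      cases o with
      | none => simp [β]
      | some a => exact mul_le_of_le hc le_rfl hι
    refine (sum_le_sum _ _ hβ).trans ?_
    rw [sum_const']
    refine mul_le_of_le (hc.trans hcc) ?_ le_rfl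
    rw [mk_option]
    exact add_le_of_le (hc.trans hcc) (hA.trans hcc) (one_le_aleph0.trans (hc.trans hcc))

section Purity

variable {R : Type u} [CommRing R]

open Cardinal in
theorem mk_span_range_le {ι M : Type u} [AddCommGroup M] [Module R M] (v : ι → M) :
    #(Submodule.span R (Set.range v)) ≤ #(ι →₀ R) := by
  rw [← Finsupp.range_linearCombination]
  exact mk_le_of_surjective (LinearMap.surjective_rangeRestrict _)

open Cardinal in
theorem mk_span_le_of_finite {M : Type u} [AddCommGroup M] [Module R M] {s : Set M}
    (hs : s.Finite) : #(Submodule.span R s) ≤ #(ℕ →₀ R) := by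
  have := hs.to_subtype
  obtain ⟨n, ⟨e⟩⟩ := Finite.exists_equiv_fin s
  have h := mk_span_range_le (R := R) (Subtype.val : s → M)
  rw [Subtype.range_coe] at h
  exact h.trans (mk_le_of_injective
    (Finsupp.embDomain_injective (M := R) (e.toEmbedding.trans Fin.valEmbedding)))

/-- For a given target `N`, every linear map `f : M → N` admits a submodule `X` of bounded
cardinality such that each small submodule of `M` maps into `X` over `N` and relative to `X`. -/
theorem exists_submodule_absorbing (Λ N : Type u) (hΛ : Cardinal.mk (ℕ →₀ R) ≤ Cardinal.mk Λ)
    [AddCommGroup N] [Module R N] :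
    ∃ κ : Cardinal.{u}, ∀ (M : Type u) [AddCommGroup M] [Module R M] (f : M →ₗ[R] N) (x : M),
      ∃ X : Submodule R M, x ∈ X ∧ Cardinal.mk X ≤ κ ∧
        ∀ S : Submodule R M, Cardinal.mk S ≤ Cardinal.mk Λ →
          ∃ φ : S →ₗ[R] M, (∀ s, φ s ∈ X) ∧ (∀ s : S, (s : M) ∈ X → φ s = s) ∧
            ∀ s, f (φ s) = f s := by
  classical
  refine ⟨2 ^ (max (max (Cardinal.mk (Set (Λ →₀ R) × (Λ → N) × Set Λ × Λ)) (Cardinal.mk Λ))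
    Cardinal.aleph0), fun M _ _ f x => ?_⟩
  let realizes (rel : Set (Λ →₀ R)) (g : Λ → N) (I : Set Λ) (d s : Λ → M) : Prop :=
    (∀ c ∈ rel, Finsupp.linearCombination R s c = 0) ∧ (∀ i, f (s i) = g i) ∧ ∀ i ∈ I, s i = d i
  obtain ⟨X, hxX, hX, hcard⟩ := exists_closed_set
    (fun (a : Set (Λ →₀ R) × (Λ → N) × Set Λ × Λ) (d : Λ → M) =>
      if h : ∃ s, realizes a.1 a.2.1 a.2.2.1 d s then h.choose a.2.2.2 else 0) x
  have key : ∀ S : Submodule R M, Cardinal.mk S ≤ Cardinal.mk Λ →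
      ∃ φ : S →ₗ[R] M, (∀ s, φ s ∈ X) ∧ (∀ s : S, (s : M) ∈ X → φ s = s) ∧
        ∀ s, f (φ s) = f s := by
    intro S hS
    obtain ⟨e⟩ := hS
    let s : Λ → S := Function.invFun e
    have hs : Function.Surjective s := Function.invFun_surjective e.injective
    let π : (Λ →₀ R) →ₗ[R] S := Finsupp.linearCombination R s
    have hπ : Function.Surjective π := fun y => by
      obtain ⟨i, rfl⟩ := hs y
      exact ⟨Finsupp.single i 1, by simp [π]⟩
    let d : Λ → M := fun i => if (s i : M) ∈ X then s i else x
    have hd : ∀ i, d i ∈ X := fun i => by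
      by_cases h : (s i : M) ∈ X <;> simp [d, h, hxX]
    have hex : ∃ t, realizes (LinearMap.ker π) (fun i => f (s i)) {i | (s i : M) ∈ X} d t := by
      refine ⟨fun i => s i, fun c hc => ?_, fun i => rfl, fun i hi => ?_⟩
      · have : S.subtype (π c) = 0 := by rw [LinearMap.mem_ker.1 hc, map_zero]
        rw [Finsupp.apply_linearCombination] at this
        exact this
      · simp only [Set.mem_ofPred_eq] at hi
        simp [d, hi]
    have htX : ∀ i, hex.choose i ∈ X := fun i => by
      have := hX (LinearMap.ker π, fun i => f (s i), {i | (s i : M) ∈ X}, i) d hd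
      simp only at this
      rwa [dif_pos hex] at this
    obtain ⟨h1, h2, h3⟩ := hex.choose_spec
    set t := hex.choose
    let φ : S →ₗ[R] M := (LinearMap.ker π).liftQ (Finsupp.linearCombination R t)
      (fun c hc => h1 c hc) ∘ₗ (π.quotKerEquivOfSurjective hπ).symm.toLinearMap
    have hφ : ∀ i, φ (s i) = t i := by
      intro i
      have : (π.quotKerEquivOfSurjective hπ).symm (s i)
          = Submodule.Quotient.mk (Finsupp.single i 1) := by
        rw [LinearEquiv.symm_apply_eq]
        simp [π]
      rw [LinearMap.comp_apply, LinearEquiv.coe_coe, this]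
      exact (Submodule.liftQ_apply _ _ _).trans (by simp)
    refine ⟨φ, fun y => ?_, fun y hy => ?_, fun y => ?_⟩ <;> obtain ⟨i, rfl⟩ := hs y
    · rw [hφ]; exact htX i
    · rw [hφ, h3 i hy]
      simp [d, hy]
    · rw [hφ, h2]
  have key2 : ∀ y ∈ X, ∀ z ∈ X, ∀ w ∈ Submodule.span R {y, z}, w ∈ X := by
    intro y hy z hz w hw
    have hle : Cardinal.mk (Submodule.span R {y, z}) ≤ Cardinal.mk Λ := by
      exact (mk_span_le_of_finite (Set.toFinite {y, z})).trans hΛ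
    obtain ⟨φ, h1, h2, -⟩ := key _ hle
    have : ∀ w (hw : w ∈ Submodule.span R {y, z}), φ ⟨w, hw⟩ = w := by
      intro w hw
      have hy' : y ∈ Submodule.span R {y, z} := Submodule.subset_span (by simp)
      have hz' : z ∈ Submodule.span R {y, z} := Submodule.subset_span (by simp)
      obtain ⟨a, b, rfl⟩ := Submodule.mem_span_pair.1 hw
      have : (⟨a • y + b • z, hw⟩ : Submodule.span R {y, z}) = a • ⟨y, hy'⟩ + b • ⟨z, hz'⟩ := rfl
      rw [this, map_add, map_smul, map_smul, h2 ⟨y, hy'⟩ hy, h2 ⟨z, hz'⟩ hz]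
    rw [← this w hw]
    exact h1 _
  let X' : Submodule R M :=
    { carrier := X
      zero_mem' := key2 x hxX x hxX 0 (zero_mem _)
      add_mem' := fun {a b} ha hb => key2 a ha b hb _
        (add_mem (Submodule.subset_span (by simp)) (Submodule.subset_span (by simp)))
      smul_mem' := fun r a ha => key2 a ha a ha _
        (Submodule.smul_mem _ _ (Submodule.subset_span (by simp))) }
  exact ⟨X', hxX, hcard, key⟩

/-- A submodule `P` of `M` with `IM ∩ P = IP` for all ideals `I`. -/
def IsIdealPure {M : Type u} [AddCommGroup M] [Module R M] (P : Submodule R M) : Prop :=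
  ∀ I : Ideal R, ∀ p ∈ P, p ∈ I • (⊤ : Submodule R M) → p ∈ I • P

theorem mem_smul_of_linearMap {M M' : Type u} [AddCommGroup M] [Module R M]
    [AddCommGroup M'] [Module R M'] {S : Submodule R M} (φ : S →ₗ[R] M') {Y : Submodule R M'}
    (hφ : ∀ s, φ s ∈ Y) {I : Ideal R} (s : S) (hs : (s : M) ∈ I • S) : φ s ∈ I • Y := by
  have := Submodule.mem_map_of_mem (f := φ) ((Submodule.mem_smul_top_iff I S s).2 hs)
  rw [Submodule.map_smul''] at this
  refine Submodule.smul_mono le_rfl ?_ this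
  rintro _ ⟨y, -, rfl⟩
  exact hφ y

theorem exists_finite_mem_smul_span {M : Type u} [AddCommGroup M] [Module R M] {I : Ideal R}
    {x : M} (hx : x ∈ I • (⊤ : Submodule R M)) :
    ∃ s : Set M, s.Finite ∧ x ∈ I • Submodule.span R s := by
  induction hx using Submodule.smul_induction_on' with
  | smul r hr m hm =>
    exact ⟨{m}, Set.finite_singleton m,
      Submodule.smul_mem_smul hr (Submodule.mem_span_singleton_self m)⟩
  | add x _ y _ hx hy =>
    obtain ⟨s, hs, hxs⟩ := hx
    obtain ⟨t, ht, hyt⟩ := hy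
    exact ⟨s ∪ t, hs.union ht, add_mem
      (Submodule.smul_mono le_rfl (Submodule.span_mono Set.subset_union_left) hxs)
      (Submodule.smul_mono le_rfl (Submodule.span_mono Set.subset_union_right) hyt)⟩

/-- Every element lies in an ideal-pure submodule of bounded cardinality. -/
theorem exists_small_isIdealPure (R : Type u) [CommRing R] :
    ∃ κ : Cardinal.{u}, ∀ (M : Type u) [AddCommGroup M] [Module R M] (x : M),
      ∃ T : Submodule R M, x ∈ T ∧ Cardinal.mk T ≤ κ ∧ IsIdealPure T := by
  obtain ⟨κ, hκ⟩ := exists_submodule_absorbing (R := R) (ℕ →₀ R) PUnit.{u + 1} le_rfl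
  refine ⟨κ, fun M _ _ x => ?_⟩
  obtain ⟨T, hxT, hT, h⟩ := hκ M 0 x
  refine ⟨T, hxT, hT, fun I p hp hpI => ?_⟩
  obtain ⟨s, hs, hps⟩ := exists_finite_mem_smul_span hpI
  obtain ⟨φ, h1, h2, -⟩ := h _ (mk_span_le_of_finite hs)
  have hp' : p ∈ Submodule.span R s := Submodule.smul_le_right hps
  have := mem_smul_of_linearMap φ h1 ⟨p, hp'⟩ hps
  rwa [h2 ⟨p, hp'⟩ hp] at this

/-- The kernel of a linear map from a large module to a fixed module contains a nonzero
ideal-pure submodule. -/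
theorem exists_isIdealPure_le_ker (N : Type u) [AddCommGroup N] [Module R N] :
    ∃ κ : Cardinal.{u}, ∀ (M : Type u) [AddCommGroup M] [Module R M] (f : M →ₗ[R] N),
      κ < Cardinal.mk M → ∃ P : Submodule R M, P ≠ ⊥ ∧ P ≤ LinearMap.ker f ∧ IsIdealPure P := by
  obtain ⟨κ₀, hκ₀⟩ := exists_small_isIdealPure R
  obtain ⟨κ, hκ⟩ := exists_submodule_absorbing (R := R) ((κ₀.out ⊕ ℕ) →₀ R) N
    (Cardinal.mk_le_of_injective (Finsupp.embDomain_injective (M := R) Function.Embedding.inr))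
  refine ⟨κ, fun M _ _ f hM => ?_⟩
  obtain ⟨X, -, hX, habs⟩ := hκ M f 0
  obtain ⟨y, hy⟩ : ∃ y, y ∉ X := by
    by_contra! h
    have : X = ⊤ := eq_top_iff.2 fun y _ => h y
    subst this
    exact (hM.trans_le ((Cardinal.mk_congr (Submodule.topEquiv (R := R)).toEquiv).ge)).not_ge hX
  obtain ⟨T, hyT, hT, hTpure⟩ := hκ₀ (M ⧸ X) (X.mkQ y)
  let v : T → M := fun t => Function.surjInv X.mkQ_surjective t
  have hv : ∀ t, X.mkQ (v t) = t := fun t => Function.surjInv_eq X.mkQ_surjective t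
  have hST : (Submodule.span R (Set.range v)).map X.mkQ = T := by
    rw [Submodule.map_span, ← Set.range_comp]
    have : X.mkQ ∘ v = Subtype.val := funext hv
    rw [this, Subtype.range_coe]
    exact Submodule.span_eq T
  have hS : Cardinal.mk (Submodule.span R (Set.range v)) ≤
      Cardinal.mk ((κ₀.out ⊕ ℕ) →₀ R) := by
    rw [← Cardinal.mk_out κ₀] at hT
    obtain ⟨e⟩ := hT
    exact (mk_span_range_le v).trans (Cardinal.mk_le_of_injective
      (Finsupp.embDomain_injective (M := R) (e.trans Function.Embedding.inl)))
  set S := Submodule.span R (Set.range v)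
  obtain ⟨φ, hφX, hφid, hφf⟩ := habs S hS
  let δ : S →ₗ[R] M := S.subtype - φ
  refine ⟨LinearMap.range δ, fun h => hy ?_, ?_, ?_⟩
  · let s₀ : S := ⟨v ⟨_, hyT⟩, Submodule.subset_span ⟨_, rfl⟩⟩
    have h0 : δ s₀ = 0 := by
      have : δ s₀ ∈ LinearMap.range δ := ⟨_, rfl⟩
      rwa [h] at this
    have hs₀ : (s₀ : M) ∈ X := by
      have : (s₀ : M) = φ s₀ := sub_eq_zero.1 h0
      rw [this]
      exact hφX s₀
    rw [← Submodule.Quotient.mk_eq_zero, ← Submodule.mkQ_apply] at hs₀ ⊢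
    exact (hv ⟨_, hyT⟩).symm.trans hs₀
  · rintro _ ⟨s, rfl⟩
    simp [δ, hφf]
  · rintro I _ ⟨s, rfl⟩ hp
    have h1 : X.mkQ (δ s) = X.mkQ s := by
      have : X.mkQ (φ s) = 0 := (Submodule.Quotient.mk_eq_zero X).2 (hφX s)
      simp only [δ, LinearMap.sub_apply, map_sub, this, sub_zero, Submodule.subtype_apply]
    have h2 : X.mkQ s ∈ I • T := by
      refine hTpure I _ (hST ▸ Submodule.mem_map_of_mem s.2) ?_
      rw [← h1]
      have := Submodule.mem_map_of_mem (f := X.mkQ) hp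
      rw [Submodule.map_smul''] at this
      exact Submodule.smul_mono le_rfl le_top this
    rw [← hST, ← Submodule.map_smul''] at h2
    obtain ⟨s', hs', hss'⟩ := h2
    have hs'S : s' ∈ S := Submodule.smul_le_right hs'
    have h3 : δ s = δ ⟨s', hs'S⟩ := by
      rw [← sub_eq_zero, ← map_sub]
      refine sub_eq_zero.2 (Eq.symm (hφid (s - ⟨s', hs'S⟩) ?_))
      rw [← Submodule.Quotient.mk_eq_zero, ← Submodule.mkQ_apply]
      exact (map_sub X.mkQ (s : M) s').trans (sub_eq_zero.2 hss'.symm)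
    rw [h3]
    exact mem_smul_of_linearMap δ (LinearMap.mem_range_self δ) ⟨s', hs'S⟩ hs'

section

variable {M : Type u} [AddCommGroup M] [Module R M]

theorem IsIdealPure.comap_mkQ {P : Submodule R M} (hP : IsIdealPure P)
    {Q : Submodule R (M ⧸ P)} (hQ : IsIdealPure Q) : IsIdealPure (Q.comap P.mkQ) := by
  intro I q hq hqI
  have h : P.mkQ q ∈ I • Q := by
    refine hQ I _ hq ?_
    have := Submodule.mem_map_of_mem (f := P.mkQ) hqI
    rw [Submodule.map_smul''] at this
    exact Submodule.smul_mono le_rfl le_top this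
  rw [← Submodule.map_comap_eq_of_surjective P.mkQ_surjective Q, ← Submodule.map_smul''] at h
  obtain ⟨q', hq', hqq'⟩ := h
  have hsub : q - q' ∈ P := by
    rw [← Submodule.Quotient.mk_eq_zero, ← Submodule.mkQ_apply, map_sub, hqq', sub_self]
  have := hP I _ hsub (sub_mem hqI (Submodule.smul_mono le_rfl le_top hq'))
  rw [← sub_add_cancel q q']
  refine add_mem (Submodule.smul_mono le_rfl (fun p hp => ?_) this) hq'
  have hp0 : P.mkQ p = 0 := (Submodule.Quotient.mk_eq_zero P).2 hp
  rw [Submodule.mem_comap, hp0]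
  exact zero_mem _

theorem IsIdealPure.sSup {c : Set (Submodule R M)} (hc : IsChain (· ≤ ·) c) (hne : c.Nonempty)
    (h : ∀ P ∈ c, IsIdealPure P) : IsIdealPure (sSup c) := by
  intro I p hp hpI
  obtain ⟨P, hPc, hpP⟩ := (Submodule.mem_sSup_of_directed hne hc.directedOn).1 hp
  exact Submodule.smul_mono le_rfl (le_sSup hPc) (h P hPc I p hpP hpI)

theorem IsIdealPure.flat_quotient [Module.Flat R M] {P : Submodule R M} (hP : IsIdealPure P) :
    Module.Flat R (M ⧸ P) := by
  refine Module.Flat.of_forall_isTrivialRelation fun {l r x} hx => ?_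
  choose y hy using fun i => P.mkQ_surjective (x i)
  have hmem : ∑ i, r i • y i ∈ P := by
    rw [← Submodule.Quotient.mk_eq_zero, ← Submodule.mkQ_apply, map_sum]
    simpa [hy] using hx
  have hI : ∑ i, r i • y i ∈ Ideal.span (Set.range r) • (⊤ : Submodule R M) :=
    sum_mem fun i _ => Submodule.smul_mem_smul (Ideal.subset_span ⟨i, rfl⟩) trivial
  have h := hP _ _ hmem hI
  generalize hw : ∑ i, r i • y i = w at h
  obtain ⟨p, hpP, hp⟩ : ∃ p : Fin l → M, (∀ i, p i ∈ P) ∧ ∑ i, r i • p i = w := by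
    clear hw
    induction h using Submodule.smul_induction_on' with
    | smul a ha n hn =>
      obtain ⟨c, rfl⟩ := (Ideal.mem_span_range_iff_exists_fun).1 ha
      refine ⟨fun i => c i • n, fun i => P.smul_mem _ hn, ?_⟩
      simp [Finset.sum_smul, mul_smul, smul_comm (r _) (c _) n]
    | add a _ b _ ha hb =>
      obtain ⟨p, hpP, rfl⟩ := ha
      obtain ⟨q, hqP, rfl⟩ := hb
      exact ⟨p + q, fun i => P.add_mem (hpP i) (hqP i), by simp [Finset.sum_add_distrib]⟩
  obtain ⟨k, a, z, hz, ha⟩ := Module.Flat.isTrivialRelation_of_sum_smul_eq_zero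
    (f := r) (x := fun i => y i - p i) (by simp [smul_sub, hp, hw])
  refine ⟨k, a, fun j => P.mkQ (z j), fun i => ?_, ha⟩
  have hp0 : P.mkQ (p i) = 0 := (Submodule.Quotient.mk_eq_zero P).2 (hpP i)
  have := congrArg P.mkQ (hz i)
  rw [map_sub, hp0, sub_zero, hy, map_sum] at this
  simpa using this

end

/-- Every map from a flat module to `N` factors through a flat quotient of bounded cardinality. -/
theorem exists_small_flat_quotient (N : Type u) [AddCommGroup N] [Module R N] :
    ∃ κ : Cardinal.{u}, ∀ (M : Type u) [AddCommGroup M] [Module R M] [Module.Flat R M]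
      (f : M →ₗ[R] N), ∃ P : Submodule R M, P ≤ LinearMap.ker f ∧
        Module.Flat R (M ⧸ P) ∧ Cardinal.mk (M ⧸ P) ≤ κ := by
  obtain ⟨κ, hκ⟩ := exists_isIdealPure_le_ker (R := R) N
  refine ⟨κ, fun M _ _ _ f => ?_⟩
  obtain ⟨P, -, ⟨hPpure, hPf⟩, hmax⟩ := zorn_le_nonempty₀
    {P : Submodule R M | IsIdealPure P ∧ P ≤ LinearMap.ker f}
    (fun c hc hchain P hP => ⟨sSup c,
      ⟨IsIdealPure.sSup hchain ⟨P, hP⟩ fun Q hQ => (hc hQ).1, sSup_le fun Q hQ => (hc hQ).2⟩,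
      fun Q hQ => le_sSup hQ⟩)
    ⊥ ⟨fun I p hp _ => by rw [(Submodule.mem_bot R).1 hp]; exact zero_mem _, bot_le⟩
  refine ⟨P, hPf, hPpure.flat_quotient, ?_⟩
  by_contra! hlt
  obtain ⟨Q, hQ0, hQf, hQ⟩ := hκ (M ⧸ P) (P.liftQ f hPf) hlt
  have hle := hmax ⟨hPpure.comap_mkQ hQ, fun x hx => by simpa using! hQf hx⟩
    (fun p hp => by
      have hp0 : P.mkQ p = 0 := (Submodule.Quotient.mk_eq_zero P).2 hp
      rw [Submodule.mem_comap, hp0]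
      exact zero_mem _)
  refine hQ0 (eq_bot_iff.2 fun q hq => ?_)
  obtain ⟨x, rfl⟩ := P.mkQ_surjective q
  exact (Submodule.Quotient.mk_eq_zero P).2 (hle hq)

end Purity

section Chains

open Limits

variable {R : Type u} [CommRing R] {N : ModuleCat.{u} R}

section Colimits

variable {I : Type u} [Category.{u} I] {K : I ⥤ Over N} {c : Cocone K}

theorem over_cocone_w_apply {i j : I} (f : i ⟶ j) (y : (K.obj i).left) :
    (c.ι.app j).left ((K.map f).left y) = (c.ι.app i).left y := by
  rw [← c.w f]
  rfl

variable [IsFiltered I]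

theorem over_isColimit_exists_rep (hc : IsColimit c) (x : c.pt.left) :
    ∃ i, ∃ y : (K.obj i).left, (c.ι.app i).left y = x :=
  Concrete.isColimit_exists_rep _ (isColimitOfPreserves (Over.forget N) hc) x

theorem over_isColimit_exists_map_eq_zero (hc : IsColimit c) {i : I} (y : (K.obj i).left)
    (hy : (c.ι.app i).left y = 0) : ∃ (j : I) (f : i ⟶ j), (K.map f).left y = 0 := by
  obtain ⟨k, f, g, h⟩ := Concrete.isColimit_exists_of_rep_eq _
    (isColimitOfPreserves (Over.forget N) hc) y 0 (i := i) (j := i) (by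
      exact hy.trans (map_zero (c.ι.app i).left.hom).symm)
  exact ⟨k, f, h.trans (map_zero (K.map g).left.hom)⟩

theorem over_isColimit_exists_rep_finite (hc : IsColimit c) {l : ℕ} (x : Fin l → c.pt.left) :
    ∃ i, ∃ y : Fin l → (K.obj i).left, ∀ k, (c.ι.app i).left (y k) = x k := by
  classical
  choose i y hy using fun k => over_isColimit_exists_rep hc (x k)
  obtain ⟨j, hj⟩ := IsFiltered.sup_objs_exists (Finset.univ.image i)
  have f : ∀ k, i k ⟶ j := fun k => (hj (by simp)).some
  refine ⟨j, fun k => (K.map (f k)).left (y k), fun k => ?_⟩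
  rw [← hy k, over_cocone_w_apply]

theorem over_isColimit_flat (hc : IsColimit c) (hK : ∀ i, Module.Flat R (K.obj i).left) :
    Module.Flat R c.pt.left := by
  refine Module.Flat.of_forall_isTrivialRelation fun {l r x} hx => ?_
  obtain ⟨i, y, hy⟩ := over_isColimit_exists_rep_finite hc x
  obtain ⟨j, f, hf⟩ := over_isColimit_exists_map_eq_zero hc (∑ k, r k • y k)
    (by simpa [hy] using hx)
  have := hK j
  obtain ⟨n, a, z, hz, ha⟩ := Module.Flat.isTrivialRelation_of_sum_smul_eq_zero
    (f := r) (x := fun k => (K.map f).left (y k)) (by simpa using hf)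
  refine ⟨n, a, fun k => (c.ι.app j).left (z k), fun k => ?_, ha⟩
  rw [← hy k, ← over_cocone_w_apply f]
  have := congrArg (c.ι.app j).left (hz k)
  simpa using this

end Colimits

variable (J : Type u) [LinearOrder J] [OrderBot J] [SuccOrder J] [WellFoundedLT J] [NoMaxOrder J]

/-- Transfinite chains of flat modules over `N` whose successor stages are all isomorphic to a
given `W`. -/
theorem exists_flat_chain (W : Over N) [Module.Flat R W.left]
    (Q : ∀ X : Over N, (X ⟶ W) → Prop)
    (hQ : ∀ X : Over N, Module.Flat R X.left → ∃ t : X ⟶ W, Q X t) :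
    ∃ G : J ⥤ Over N, G.IsWellOrderContinuous ∧ (∀ j, Module.Flat R (G.obj j).left) ∧
      Nonempty (G.obj ⊥ ≅ W) ∧
      ∀ j, ∃ e : G.obj (Order.succ j) ≅ W,
        Q _ (G.map (homOfLE (Order.le_succ j)) ≫ e.hom) := by
  have H : ∀ X : Over N, ∃ (Y : Over N) (t : X ⟶ Y), Module.Flat R X.left →
      ∃ e : Y ≅ W, Q X (t ≫ e.hom) := by
    intro X
    by_cases hX : Module.Flat R X.left
    · obtain ⟨t, ht⟩ := hQ X hX
      exact ⟨W, t, fun _ => ⟨Iso.refl _, by simpa using ht⟩⟩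
    · exact ⟨X, 𝟙 X, fun h => (hX h).elim⟩
  choose S t ht using H
  let Φ : SmallObject.SuccStruct (Over N) := ⟨W, S, t⟩
  have hsucc : ∀ j, Module.Flat R ((Φ.iterationFunctor J).obj j).left →
      ∃ e : (Φ.iterationFunctor J).obj (Order.succ j) ≅ W,
        Q _ ((Φ.iterationFunctor J).map (homOfLE (Order.le_succ j)) ≫ e.hom) := by
    intro j hj
    obtain ⟨e, he⟩ := ht _ hj
    refine ⟨Φ.iterationFunctorObjSuccIso j (not_isMax j) ≪≫ e, ?_⟩
    rw [Φ.iterationFunctor_map_succ j (not_isMax j)]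
    simpa using he
  have flat_of_iso : ∀ {X : Over N}, (X ≅ W) → Module.Flat R X.left := fun {X} e =>
    let l : X.left ≃ₗ[R] W.left := ((Over.forget N).mapIso e).toLinearEquiv
    Module.Flat.of_linearEquiv l
  have hflat : ∀ j, Module.Flat R ((Φ.iterationFunctor J).obj j).left := by
    intro j
    induction j using SuccOrder.limitRecOn with
    | isMin j hj =>
      obtain rfl := hj.eq_bot
      exact flat_of_iso (Φ.iterationFunctorObjBotIso J)
    | succ j _ hj => exact flat_of_iso (hsucc j hj).choose
    | isSuccLimit j hj ih =>
      have : Nonempty (Set.Iio j) := ⟨⟨⊥, hj.bot_lt⟩⟩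
      exact over_isColimit_flat ((Φ.iterationFunctor J).isColimitOfIsWellOrderContinuous j hj)
        fun i => ih i.1 i.2
  exact ⟨Φ.iterationFunctor J, inferInstance, hflat, ⟨Φ.iterationFunctorObjBotIso J⟩,
    fun j => hsucc j (hflat j)⟩

end Chains

section Covers

/-- Well-ordered index sets without maximum, large and closed under bounds of small families. -/
theorem exists_wellOrder_mk_gt_bddAbove (κ : Cardinal.{u}) (hκ : Cardinal.aleph0 ≤ κ) :
    ∃ (J : Type u) (_ : LinearOrder J) (_ : OrderBot J) (_ : SuccOrder J) (_ : WellFoundedLT J)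
      (_ : NoMaxOrder J), κ < Cardinal.mk J ∧
        ∀ (ι : Type u) (f : ι → J), Cardinal.mk ι ≤ κ → BddAbove (Set.range f) := by
  have hreg := Cardinal.isRegular_succ hκ
  have := Fact.mk hreg
  have := Cardinal.noMaxOrder hreg.aleph0_le
  have : Nonempty (Order.succ κ).ord.ToType :=
    Cardinal.mk_ne_zero_iff.1 (by simp)
  refine ⟨(Order.succ κ).ord.ToType, inferInstance, WellFoundedLT.toOrderBot _,
    SuccOrder.ofLinearWellFoundedLT _, inferInstance, inferInstance, ?_, fun ι f hι => ?_⟩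
  · simp
  · have h : HasCardinalLT ι (Order.succ κ) := by
      rw [hasCardinalLT_iff_cardinal_mk_lt]
      exact Order.lt_succ_of_le hι
    refine ⟨IsCardinalFiltered.max f h, ?_⟩
    rintro _ ⟨i, rfl⟩
    exact leOfHom (IsCardinalFiltered.toMax f h i)

variable {R : Type u} [CommRing R] (N : ModuleCat.{u} R)

variable {N} in
theorem exists_flat_forall_hom {ι : Type u} (B : ι → Over N)
    (hB : ∀ i, Module.Flat R (B i).left) :
    ∃ W : Over N, Module.Flat R W.left ∧ ∀ i, Nonempty (B i ⟶ W) := by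
  classical
  let φ : DirectSum ι (fun i => (B i).left) →ₗ[R] N :=
    DirectSum.toModule R ι N fun i => (B i).hom.hom
  refine ⟨Over.mk (Y := ModuleCat.of R (DirectSum ι fun i => (B i).left)) (ModuleCat.ofHom φ),
    Module.Flat.directSum_iff.2 hB, fun i => ⟨Over.homMk (ModuleCat.ofHom
      (DirectSum.lof R ι (fun i => (B i).left) i)) ?_⟩⟩
  ext x
  exact DirectSum.toModule_lof R (φ := fun i => (B i).hom.hom) i x

/-- Flat precovers exist. -/
theorem exists_weaklyTerminal_flat :
    ∃ W : Over N, Module.Flat R W.left ∧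
      ∀ X : Over N, Module.Flat R X.left → Nonempty (X ⟶ W) := by
  obtain ⟨κ, hκ⟩ := exists_small_flat_quotient (R := R) N
  let E := κ.out →₀ R
  let ι := Σ L : {L : Submodule R E // Module.Flat R (E ⧸ L)}, ((E ⧸ L.1) →ₗ[R] N)
  let B : ι → Over N := fun i => Over.mk (Y := ModuleCat.of R (E ⧸ i.1.1)) (ModuleCat.ofHom i.2)
  obtain ⟨W, hWf, hW⟩ := exists_flat_forall_hom B fun i => i.1.2
  refine ⟨W, hWf, fun X hX => ?_⟩
  obtain ⟨P, hP, hflat, hcard⟩ := hκ X.left X.hom.hom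
  obtain ⟨s, hs⟩ : ∃ s : κ.out → X.left ⧸ P, Function.Surjective s := by
    rw [← Cardinal.mk_out κ, Cardinal.le_def] at hcard
    obtain ⟨i⟩ := hcard
    exact ⟨Function.invFun i, Function.invFun_surjective i.injective⟩
  let p : E →ₗ[R] X.left ⧸ P := Finsupp.linearCombination R s
  have hp : Function.Surjective p := fun x => by
    obtain ⟨k, rfl⟩ := hs x
    exact ⟨Finsupp.single k 1, by rw [Finsupp.linearCombination_single, one_smul]⟩
  let e := p.quotKerEquivOfSurjective hp
  let i : ι := ⟨⟨LinearMap.ker p, Module.Flat.of_linearEquiv e⟩,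
    (P.liftQ X.hom.hom hP).comp e.toLinearMap⟩
  obtain ⟨t⟩ := hW i
  refine ⟨Over.homMk (V := B i) (ModuleCat.ofHom (e.symm.toLinearMap ∘ₗ P.mkQ)) ?_ ≫ t⟩
  ext x
  change P.liftQ X.hom.hom hP (e (e.symm (P.mkQ x))) = X.hom.hom x
  simp

variable {N}

/-- Some flat module over `N` maps injectively to every flat module over `N` it maps to. -/
theorem exists_weaklyTerminal_flat_injective (W : Over N) [Module.Flat R W.left]
    (hW : ∀ X : Over N, Module.Flat R X.left → Nonempty (X ⟶ W)) :
    ∃ Z : Over N, Module.Flat R Z.left ∧ Nonempty (W ⟶ Z) ∧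
      ∀ (Y : Over N) (h : Z ⟶ Y), Module.Flat R Y.left → Function.Injective h.left := by
  obtain ⟨J, _, _, _, _, _, -, hJ⟩ :=
    exists_wellOrder_mk_gt_bddAbove (max (Cardinal.mk W.left) Cardinal.aleph0) (le_max_right _ _)
  obtain ⟨G, hG, hflat, ⟨e₀⟩, hsucc⟩ := exists_flat_chain J W
    (fun X t => (∃ (Y : Over N) (h : X ⟶ Y), Module.Flat R Y.left ∧
      ¬ Function.Injective h.left) → ¬ Function.Injective t.left) fun X hX => by
    by_cases H : ∃ (Y : Over N) (h : X ⟶ Y), Module.Flat R Y.left ∧ ¬ Function.Injective h.left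
    · obtain ⟨Y, h, hY, hh⟩ := H
      obtain ⟨t⟩ := hW Y hY
      refine ⟨h ≫ t, fun _ hi => hh ?_⟩
      exact Function.Injective.of_comp (f := t.left) hi
    · exact ⟨(hW X hX).some, fun h => (H h).elim⟩
  have step : ∀ j : J, ∃ k : J, j < k ∧ ∀ (y : (G.obj (Order.succ j)).left) (m : J)
      (hm : Order.succ j ≤ m), (G.map (homOfLE hm)).left y = 0 →
      ∃ hk : Order.succ j ≤ k, (G.map (homOfLE hk)).left y = 0 := by
    intro j
    obtain ⟨e, -⟩ := hsucc j
    have hb : ∀ y : (G.obj (Order.succ j)).left, ∃ b : J, Order.succ j ≤ b ∧ ∀ (m : J)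
        (hm : Order.succ j ≤ m), (G.map (homOfLE hm)).left y = 0 →
        ∃ hk : Order.succ j ≤ b, (G.map (homOfLE hk)).left y = 0 := by
      intro y
      by_cases H : ∃ (m : J) (hm : Order.succ j ≤ m), (G.map (homOfLE hm)).left y = 0
      · obtain ⟨m, hm, h⟩ := H
        exact ⟨m, hm, fun _ _ _ => ⟨hm, h⟩⟩
      · exact ⟨Order.succ j, le_rfl, fun m hm h => (H ⟨m, hm, h⟩).elim⟩
    choose b hjb hb using hb
    have hcard : Cardinal.mk (G.obj (Order.succ j)).left = Cardinal.mk W.left :=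
      Cardinal.mk_congr (((Over.forget N).mapIso e).toLinearEquiv.toEquiv)
    obtain ⟨k, hk⟩ := hJ _ b (hcard.le.trans (le_max_left _ _))
    have hk' : ∀ y, b y ≤ k := fun y => hk ⟨y, rfl⟩
    have hjk := (hjb 0).trans (hk' 0)
    refine ⟨k, Order.succ_le_iff.1 hjk, fun y m hm h => ⟨hjk, ?_⟩⟩
    obtain ⟨h₁, h₂⟩ := hb y m hm h
    have : homOfLE hjk = homOfLE h₁ ≫ homOfLE (hk' y) := rfl
    rw [this, G.map_comp]
    change (G.map (homOfLE (hk' y))).left ((G.map (homOfLE h₁)).left y) = 0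
    rw [h₂, map_zero]
  choose k hlt hk using step
  let s : ℕ → J := fun n => k^[n] ⊥
  have hs : ∀ n, s (n + 1) = k (s n) := fun n => Function.iterate_succ_apply' _ _ _
  obtain ⟨l, hl⟩ : ∃ l, IsLUB (Set.range s) l := by
    obtain ⟨b, hb⟩ := hJ (ULift ℕ) (fun n => s n.down) (by simp)
    have hne : (upperBounds (Set.range s)).Nonempty :=
      ⟨b, by rintro _ ⟨n, rfl⟩; exact hb ⟨⟨n⟩, rfl⟩⟩
    exact ⟨_, WellFounded.min_mem wellFounded_lt _ hne,
      fun c hc => not_lt.1 (WellFounded.not_lt_min wellFounded_lt _ hc)⟩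
  have hsl : ∀ n, s n < l := fun n =>
    (hlt (s n)).trans_le (hs n ▸ hl.1 ⟨n + 1, rfl⟩)
  have hlim : Order.IsSuccLimit l := by
    refine ⟨not_isMin_of_lt (hsl 0), fun a ha => ?_⟩
    obtain ⟨_, ⟨n, rfl⟩, hn⟩ := (lt_isLUB_iff hl).1 ha.lt
    exact ha.2 hn (hsl n)
  have hlne : Nonempty (Set.Iio l) := ⟨⟨_, hsl 0⟩⟩
  have hcol := G.isColimitOfIsWellOrderContinuous l hlim
  obtain ⟨e, he⟩ := hsucc l
  have hinj : Function.Injective (G.map (homOfLE (Order.le_succ l))).left := by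
    refine (injective_iff_map_eq_zero (G.map (homOfLE (Order.le_succ l))).left.hom).2
      fun x hx => ?_
    obtain ⟨⟨i, hi⟩, (y : (G.obj i).left), rfl⟩ := over_isColimit_exists_rep hcol x
    obtain ⟨_, ⟨n, rfl⟩, hn⟩ := (lt_isLUB_iff hl).1 hi
    have hil : i ≤ l := le_of_lt hi
    have hin : i ≤ Order.succ (s n) := hn.le.trans (Order.le_succ _)
    have hnl : Order.succ (s n) ≤ l := Order.succ_le_of_lt (hsl n)
    have hcomp : ∀ {a b c : J} (hab : a ≤ b) (hbc : b ≤ c) (z : (G.obj a).left),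
        (G.map (homOfLE hbc)).left ((G.map (homOfLE hab)).left z) =
          (G.map (homOfLE (hab.trans hbc))).left z := by
      intro a b c hab hbc z
      have : homOfLE (hab.trans hbc) = homOfLE hab ≫ homOfLE hbc := rfl
      rw [this, G.map_comp]
      rfl
    change (G.map (homOfLE hil)).left y = 0
    replace hx : (G.map (homOfLE (Order.le_succ l))).left ((G.map (homOfLE hil)).left y) = 0 := hx
    rw [hcomp hil (Order.le_succ l) y, ← hcomp hin (hnl.trans (Order.le_succ l))] at hx
    obtain ⟨h₁, h₂⟩ := hk _ _ _ _ hx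
    have h₃ : k (s n) ≤ l := hs n ▸ (hsl (n + 1)).le
    rw [← hcomp (hin.trans h₁) h₃, ← hcomp hin h₁, h₂, map_zero]
  refine ⟨G.obj l, hflat l, ⟨e₀.inv ≫ G.map (homOfLE bot_le)⟩, fun Y h hY => ?_⟩
  by_contra hh
  refine he ⟨Y, h, hY, hh⟩ ?_
  have hei : Function.Injective e.hom.left :=
    ((Over.forget N).mapIso e).toLinearEquiv.injective
  exact hei.comp hinj

theorem surjective_of_forall_injective (Z : Over N) [Module.Flat R Z.left]
    (hZ : ∀ X : Over N, Module.Flat R X.left → Nonempty (X ⟶ Z))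
    (hinj : ∀ (Y : Over N) (h : Z ⟶ Y), Module.Flat R Y.left → Function.Injective h.left)
    (f : Z ⟶ Z) : Function.Surjective f.left := by
  by_contra hf
  obtain ⟨J, _, _, _, _, _, hcard, -⟩ :=
    exists_wellOrder_mk_gt_bddAbove (max (Cardinal.mk Z.left) Cardinal.aleph0) (le_max_right _ _)
  obtain ⟨G, -, hflat, -, hsucc⟩ := exists_flat_chain J Z
    (fun X t => ¬ Function.Surjective t.left) fun X hX =>
      ⟨(hZ X hX).some ≫ f, fun h => hf (Function.Surjective.of_comp h)⟩
  obtain ⟨r⟩ := hZ (Limits.colimit G) (over_isColimit_flat (Limits.colimit.isColimit G) hflat)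
  have hz : ∀ j, ∃ z : (G.obj (Order.succ j)).left,
      ∀ x, (G.map (homOfLE (Order.le_succ j))).left x ≠ z := by
    intro j
    obtain ⟨e, he⟩ := hsucc j
    by_contra! H
    have hes : Function.Surjective e.hom.left :=
      ((Over.forget N).mapIso e).toLinearEquiv.surjective
    exact he (hes.comp H)
  choose z hz using hz
  let θ : ∀ j, G.obj j ⟶ Z := fun j => Limits.colimit.ι G j ≫ r
  have hθ : ∀ j, Function.Injective (θ (Order.succ j)).left := by
    intro j
    obtain ⟨e, -⟩ := hsucc j
    have h := hinj _ (e.inv ≫ θ (Order.succ j)) inferInstance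
    have hes : Function.Surjective e.inv.left :=
      ((Over.forget N).mapIso e).toLinearEquiv.symm.surjective
    exact Function.Injective.of_comp_right h hes
  have hne : ∀ i j, i < j → (θ _).left (z i) ≠ (θ _).left (z j) := by
    intro i j hij h
    have hij' : Order.succ i ≤ j := Order.succ_le_of_lt hij
    have : θ (Order.succ i) =
        G.map (homOfLE hij') ≫ G.map (homOfLE (Order.le_succ j)) ≫ θ (Order.succ j) := by
      simp [θ]
    rw [this] at h
    exact hz j _ (hθ j h)
  have : Function.Injective fun j => (θ _).left (z j) := fun i j h => by
    rcases lt_trichotomy i j with hij | hij | hij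
    · exact (hne i j hij h).elim
    · exact hij
    · exact (hne j i hij h.symm).elim
  exact (hcard.trans_le (Cardinal.mk_le_of_injective this)).not_ge (le_max_left _ _)

/-- Flat covers exist. -/
theorem exists_flat_cover (N : ModuleCat.{u} R) :
    ∃ Z : Over N, Module.Flat R Z.left ∧
      (∀ X : Over N, Module.Flat R X.left → Nonempty (X ⟶ Z)) ∧
      ∀ f : Z ⟶ Z, Function.Bijective f.left := by
  obtain ⟨W, hWf, hW⟩ := exists_weaklyTerminal_flat N
  obtain ⟨Z, hZf, ⟨t⟩, hinj⟩ := exists_weaklyTerminal_flat_injective W hW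
  have hZ : ∀ X : Over N, Module.Flat R X.left → Nonempty (X ⟶ Z) :=
    fun X hX => ⟨(hW X hX).some ≫ t⟩
  exact ⟨Z, hZf, hZ, fun f => ⟨hinj _ f hZf, surjective_of_forall_injective Z hZ hinj f⟩⟩

end Covers

section Transfer

open TensorProduct

variable {R : Type u} [CommRing R]

theorem rTensorHomToHomRTensor_comp_rTensor_lcomp {M M' : Type u} [AddCommGroup M] [Module R M]
    [AddCommGroup M'] [Module R M'] (P F : Type u) [AddCommGroup P] [Module R P]
    [AddCommGroup F] [Module R F] (f : M →ₗ[R] M') (x : (M' →ₗ[R] P) ⊗[R] F) :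
    rTensorHomToHomRTensor (.id R) M P F ((LinearMap.lcomp R P f).rTensor F x) =
      (rTensorHomToHomRTensor (.id R) M' P F x) ∘ₗ f := by
  induction x with
  | zero => simp
  | tmul g y => ext m; simp
  | add x y hx hy => simp [hx, hy, LinearMap.add_comp]

/-- `Hom(C, P) ⊗ F ≅ Hom(C, P ⊗ F)` for `C` finitely presented and `F` flat. -/
theorem rTensorHomToHomRTensor_bijective (C P F : Type u) [AddCommGroup C] [Module R C]
    [Module.FinitePresentation R C] [AddCommGroup P] [Module R P] [AddCommGroup F] [Module R F]
    [Module.Flat R F] :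
    Function.Bijective (rTensorHomToHomRTensor (.id R) C P F) := by
  obtain ⟨n, m, f, g, hf, hfg⟩ := Module.FinitePresentation.exists_fin' R C
  have bij : ∀ k : ℕ, Function.Bijective (rTensorHomToHomRTensor (.id R) (Fin k → R) P F) :=
    fun k => by
      rw [← rTensorHomEquivHomRTensor_toLinearMap]
      exact (rTensorHomEquivHomRTensor R (Fin k → R) P F).bijective
  have hinj : Function.Injective ((LinearMap.lcomp R P f).rTensor F) :=
    Module.Flat.rTensor_preserves_injective_linearMap _
      (LinearMap.lcomp_injective_of_surjective f hf)
  have hex : Function.Exact ((LinearMap.lcomp R P f).rTensor F)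
      ((LinearMap.lcomp R P g).rTensor F) :=
    Module.Flat.rTensor_exact F (LinearMap.exact_lcomp_of_exact_of_surjective P hfg hf)
  refine ⟨fun x y hxy => hinj ((bij n).1 ?_), fun h => ?_⟩
  · rw [rTensorHomToHomRTensor_comp_rTensor_lcomp, rTensorHomToHomRTensor_comp_rTensor_lcomp, hxy]
  · obtain ⟨z, hz⟩ := (bij n).2 (h ∘ₗ f)
    obtain ⟨w, rfl⟩ := (hex z).1 ((bij m).1 (by
      rw [rTensorHomToHomRTensor_comp_rTensor_lcomp, hz, LinearMap.comp_assoc,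
        hfg.linearMap_comp_eq_zero, LinearMap.comp_zero, map_zero]))
    rw [rTensorHomToHomRTensor_comp_rTensor_lcomp] at hz
    exact ⟨w, (LinearMap.cancel_right hf).1 hz⟩

theorem etaMap_bijective [IsNoetherianRing R] {C : Type u} [AddCommGroup C] [Module R C]
    [Module.Finite R C] (hχ : Function.Bijective (fun r : R => r • (LinearMap.id : C →ₗ[R] C)))
    (F : Type u) [AddCommGroup F] [Module R F] [Module.Flat R F] :
    Function.Bijective (etaMap R C F) := by
  have : Module.FinitePresentation R C := Module.finitePresentation_of_finite R C
  let χ : R ≃ₗ[R] (C →ₗ[R] C) := LinearEquiv.ofBijective 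
    (LinearMap.toSpanSingleton R (C →ₗ[R] C) LinearMap.id) hχ
  have hχ_one : χ 1 = LinearMap.id := one_smul R _
  have h : ⇑(etaMap R C F) = rTensorHomToHomRTensor (.id R) C C F ∘
      (χ.rTensor F) ∘ (TensorProduct.lid R F).symm := by
    ext x c
    simp [hχ_one, etaMap]
  rw [h]
  exact (rTensorHomToHomRTensor_bijective C C F).comp
    ((LinearEquiv.bijective _).comp (LinearEquiv.bijective _))

end Transfer

/-- If `C` is a semidualizing module over a commutative noetherian ring `R`, then the class
`F_C` is covering: every `R`-module has an `F_C`-cover. -/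
theorem FC_covering
    (R : Type u) [CommRing R] [IsNoetherianRing R]
    (C : Type u) [AddCommGroup C] [Module R C] (hC : IsSemidualizing R C) :
    Covering R {V : ModuleCat.{u} R | memFC R C V} := by
  obtain ⟨hfin, -, hχ⟩ := hC
  intro M
  obtain ⟨Z, hZf, hZ, hZb⟩ := exists_flat_cover (ModuleCat.of R (C →ₗ[R] M))
  let φ : Z.left →ₗ[R] C →ₗ[R] M := Z.hom.hom
  refine ⟨ModuleCat.of R (TensorProduct R C Z.left), ModuleCat.ofHom (TensorProduct.lift φ.flip),
    ⟨⟨Z.left, hZf, ⟨LinearEquiv.refl R _⟩⟩, ?_⟩, fun f hf => ?_⟩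
  · rintro V ⟨F, hF, ⟨e⟩⟩ φ'
    let X : Over (ModuleCat.of R (C →ₗ[R] M)) := Over.mk (Y := F)
      (ModuleCat.ofHom (TensorProduct.mk R C F).flip ≫
        ModuleCat.ofHom (LinearMap.compRight R (φ'.hom ∘ₗ e.symm.toLinearMap)))
    obtain ⟨t⟩ := hZ X hF
    refine ⟨ModuleCat.ofHom (t.left.hom.lTensor C ∘ₗ e.toLinearMap), ?_⟩
    have key : TensorProduct.lift φ.flip ∘ₗ t.left.hom.lTensor C =
        φ'.hom ∘ₗ e.symm.toLinearMap := by
      ext c x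
      have := LinearMap.congr_fun (ConcreteCategory.congr_hom (Over.w t) x) c
      exact this
    ext v
    have := LinearMap.congr_fun key (e v)
    simpa using this
  · let η : Z.left ≃ₗ[R] (C →ₗ[R] TensorProduct R C Z.left) :=
      LinearEquiv.ofBijective _ (etaMap_bijective hχ Z.left)
    let g : Z.left →ₗ[R] Z.left := η.symm.toLinearMap ∘ₗ
      LinearMap.compRight R f.hom ∘ₗ η.toLinearMap
    have hg : ∀ x c, c ⊗ₜ[R] g x = f.hom (c ⊗ₜ x) := by
      intro x c
      have : η (g x) = LinearMap.compRight R f.hom (η x) := by simp [g]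
      exact LinearMap.congr_fun this c
    have hfg : f.hom = g.lTensor C := by
      ext c x
      exact (hg x c).symm
    have hgφ : φ ∘ₗ g = φ := by
      ext x c
      have := ConcreteCategory.congr_hom hf (c ⊗ₜ x)
      change TensorProduct.lift φ.flip (f.hom (c ⊗ₜ x)) = φ x c at this
      rw [← hg] at this
      exact this
    have hb : Function.Bijective g :=
      hZb (Over.homMk (ModuleCat.ofHom g) (ModuleCat.hom_ext hgφ))
    rw [ConcreteCategory.isIso_iff_bijective]
    change Function.Bijective f.hom
    rw [hfg]
    exact ((LinearEquiv.ofBijective g hb).lTensor C).bijective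
end

section
/- Let C be a semidualizing module over a commutative noetherian ring R. An R-module U belongs to I_C if and only if U belongs to the Auslander class A_C and the R-module C ⊗_R U is injective. -/
/-!
Common definitions: Ext/Tor vanishing, semidualizing modules, the Auslander and Bass
classes, (pre)covers and (pre)envelopes, cotorsion pairs, the classes `I_C` and `F_C`,
purity, and Kaplansky classes.
-/

open CategoryTheory

universe u

section HomEvaluation

open TensorProduct

variable {R : Type u} [CommRing R] {M N F Y I : Type u}
  [AddCommGroup M] [Module R M] [AddCommGroup N] [Module R N] [AddCommGroup F] [Module R F]
  [AddCommGroup Y] [Module R Y] [AddCommGroup I] [Module R I]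

variable (R M Y I) in
/-- The Hom-evaluation map `M ⊗ Hom(Y,I) → Hom(Hom(M,Y),I)`, `m ⊗ f ↦ (g ↦ f (g m))`. -/
def homEvaluation : TensorProduct R M (Y →ₗ[R] I) →ₗ[R] ((M →ₗ[R] Y) →ₗ[R] I) :=
  TensorProduct.lift ((LinearMap.llcomp R (M →ₗ[R] Y) Y I).flip ∘ₗ LinearMap.applyₗ)

@[simp]
lemma homEvaluation_tmul (m : M) (f : Y →ₗ[R] I) (g : M →ₗ[R] Y) :
    homEvaluation R M Y I (m ⊗ₜ f) g = f (g m) := rfl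

lemma homEvaluation_rTensor (p : M →ₗ[R] N) (x : TensorProduct R M (Y →ₗ[R] I)) :
    homEvaluation R N Y I (p.rTensor _ x) = homEvaluation R M Y I x ∘ₗ LinearMap.lcomp R Y p := by
  induction x with
  | zero => simp
  | tmul m f => rfl
  | add x y hx hy => simp [hx, hy, LinearMap.add_comp]

/-- Hom-evaluation is bijective for finite free modules. -/
lemma homEvaluation_bijective_of_free [Module.Free R F] [Module.Finite R F] :
    Function.Bijective (homEvaluation R F Y I) := by
  let b := Module.Free.chooseBasis R F
  let inv : ((F →ₗ[R] Y) →ₗ[R] I) → F ⊗[R] (Y →ₗ[R] I) := fun φ ↦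
    ∑ i, b i ⊗ₜ (φ ∘ₗ LinearMap.smulRightₗ (b.coord i))
  refine Function.bijective_iff_has_inverse.2 ⟨inv, fun x ↦ ?_, fun φ ↦ ?_⟩
  · induction x with
    | zero => simp only [inv, map_zero, LinearMap.zero_comp, TensorProduct.tmul_zero,
        Finset.sum_const_zero]
    | tmul m f =>
      have h (i) : (homEvaluation R F Y I (m ⊗ₜ f) ∘ₗ LinearMap.smulRightₗ (b.coord i)) =
          b.coord i m • f := by
        ext y; simp
      simp only [inv, h, ← TensorProduct.smul_tmul, ← TensorProduct.sum_tmul]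
      simp [b.sum_repr]
    | add x y hx hy =>
      rw [map_add]
      conv_rhs => rw [← hx, ← hy]
      simp only [inv, LinearMap.add_comp, TensorProduct.tmul_add, Finset.sum_add_distrib]
  · ext g
    simp only [inv, map_sum, LinearMap.sum_apply, homEvaluation_tmul, LinearMap.comp_apply]
    rw [← map_sum]
    congr 1
    exact b.ext fun j ↦ by simp [Finsupp.single_apply]

/-- Hom-evaluation into an injective module is surjective for finite modules. -/
lemma homEvaluation_surjective [Module.Injective R I] [Module.Finite R M] :
    Function.Surjective (homEvaluation R M Y I) := by
  intro φ
  obtain ⟨P, _, _, _, _, p, hp⟩ := Module.exists_finite_presentation R M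
  obtain ⟨φ', rfl⟩ := Module.Injective.extension_property R I _ _ (LinearMap.lcomp R Y p)
    (LinearMap.lcomp_injective_of_surjective p hp) φ
  obtain ⟨z, rfl⟩ := homEvaluation_bijective_of_free.2 φ'
  exact ⟨p.rTensor _ z, homEvaluation_rTensor p z⟩

/-- Hom-evaluation into an injective module is bijective for finite modules over a noetherian
ring. -/
lemma homEvaluation_bijective [IsNoetherianRing R] [Module.Injective R I] [Module.Finite R M] :
    Function.Bijective (homEvaluation R M Y I) := by
  refine ⟨(injective_iff_map_eq_zero _).2 fun x hx ↦ ?_, homEvaluation_surjective⟩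
  obtain ⟨P, _, _, _, _, p, hp⟩ := Module.exists_finite_presentation R M
  obtain ⟨z, rfl⟩ := LinearMap.rTensor_surjective _ hp x
  let ι := p.ker.subtype
  have hz (g : P →ₗ[R] Y) (hg : g ∘ₗ ι = 0) : homEvaluation R P Y I z g = 0 := by
    obtain ⟨g', rfl⟩ := (LinearMap.exact_lcomp_of_exact_of_surjective
      Y (LinearMap.exact_subtype_ker_map p) hp g).1 hg
    rw [homEvaluation_rTensor] at hx
    exact LinearMap.congr_fun hx g'
  obtain ⟨ψ, hψ⟩ : ∃ ψ : (p.ker →ₗ[R] Y) →ₗ[R] I,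
      ψ ∘ₗ LinearMap.lcomp R Y ι = homEvaluation R P Y I z := by
    let r := LinearMap.lcomp R Y ι
    obtain ⟨ψ, hψ⟩ := Module.Injective.extension_property R I _ _
      (r.ker.liftQ r le_rfl) (LinearMap.ker_eq_bot.1 (Submodule.ker_liftQ_eq_bot' _ r rfl))
      (r.ker.liftQ (homEvaluation R P Y I z) fun g hg ↦ hz g hg)
    refine ⟨ψ, LinearMap.ext fun g ↦ ?_⟩
    exact LinearMap.congr_fun hψ (r.ker.mkQ g)
  obtain ⟨w, rfl⟩ := homEvaluation_surjective ψ
  rw [← homEvaluation_rTensor] at hψ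
  rw [← homEvaluation_bijective_of_free.1 hψ]
  exact (rTensor_exact _ (LinearMap.exact_subtype_ker_map p) hp _).2 ⟨w, rfl⟩

/-- If every map `K → Y` extends along an injection `K → F`, then `K → F` stays injective after
tensoring with `Hom(Y,I)`. -/
lemma rTensor_hom_injective [IsNoetherianRing R] [Module.Injective R I] [Module.Finite R M]
    (i : M →ₗ[R] N) (hi : Function.Surjective (LinearMap.lcomp R Y i)) :
    Function.Injective (i.rTensor (Y →ₗ[R] I)) := by
  refine (injective_iff_map_eq_zero _).2 fun x hx ↦ homEvaluation_bijective.1 ?_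
  rw [map_zero]
  ext g
  obtain ⟨g, rfl⟩ := hi g
  have := homEvaluation_rTensor i x
  rw [hx, map_zero] at this
  exact (LinearMap.congr_fun this g).symm

end HomEvaluation

section Evaluation

variable {R : Type u} [CommRing R] {C I : Type u}
  [AddCommGroup C] [Module R C] [AddCommGroup I] [Module R I]

lemma epsMap_bijective [IsNoetherianRing R] [Module.Injective R I] [Module.Finite R C]
    (h : Function.Bijective (fun r : R => r • (LinearMap.id : C →ₗ[R] C))) :
    Function.Bijective (epsMap R C I) := by
  let e : R ≃ₗ[R] (C →ₗ[R] C) :=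
    LinearEquiv.ofBijective (LinearMap.toSpanSingleton R _ LinearMap.id) h
  have : epsMap R C I = ((e.arrowCongr (LinearEquiv.refl R I)).symm ≪≫ₗ
      LinearMap.ringLmapEquivSelf R R I).toLinearMap ∘ₗ homEvaluation R C C I := by
    ext c f
    have h1 : e 1 = LinearMap.id := one_smul R _
    simp [epsMap, h1]
  rw [this]
  exact (LinearEquiv.bijective ((e.arrowCongr (LinearEquiv.refl R I)).symm ≪≫ₗ
      LinearMap.ringLmapEquivSelf R R I)).comp homEvaluation_bijective

lemma etaMap_hom_bijective (h : Function.Bijective (epsMap R C I)) :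
    Function.Bijective (etaMap R C (C →ₗ[R] I)) := by
  let e : (C →ₗ[R] TensorProduct R C (C →ₗ[R] I)) ≃ₗ[R] (C →ₗ[R] I) :=
    (LinearEquiv.refl R C).arrowCongr (LinearEquiv.ofBijective _ h)
  have : e.toLinearMap ∘ₗ etaMap R C (C →ₗ[R] I) = LinearMap.id := by
    ext f c
    simp [e, epsMap, etaMap]
  rw [← e.bijective.of_comp_iff']
  have h2 : e ∘ etaMap R C (C →ₗ[R] I) = id := congrArg DFunLike.coe this
  rw [h2]
  exact Function.bijective_id

end Evaluation

section Derived

variable {R : Type u} [CommRing R]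

lemma torVanishes_succ_iff (M : ModuleCat.{u} R) {V : ModuleCat.{u} R}
    (P : ProjectiveResolution V) (n : ℕ) :
    torVanishes R M V (n + 1) ↔
      Function.Exact ((P.complex.d (n + 2) (n + 1)).hom.lTensor M)
        ((P.complex.d (n + 1) n).hom.lTensor M) := by
  let K := ((MonoidalCategory.tensoringLeft (ModuleCat.{u} R)).obj M).mapHomologicalComplex
    (ComplexShape.down ℕ) |>.obj P.complex
  have e : ((Tor (ModuleCat.{u} R) (n + 1)).obj M).obj V ≅ K.homology (n + 1) :=
    P.isoLeftDerivedObj _ (n + 1)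
  rw [torVanishes, ← ModuleCat.isZero_iff_subsingleton, e.isZero_iff,
    ← K.exactAt_iff_isZero_homology,
    K.exactAt_iff' (n + 2) (n + 1) n (by simp) (by simp),
    ShortComplex.ShortExact.moduleCat_exact_iff_function_exact]
  rfl

lemma extVanishes_succ_iff (M Y : ModuleCat.{u} R) (n : ℕ) :
    extVanishes R M Y (n + 1) ↔ Subsingleton (Abelian.Ext M Y (n + 1)) := by
  let P := ProjectiveResolution.of M
  let K := P.complex.linearYonedaObj R Y
  rw [extVanishes, ← ModuleCat.isZero_iff_subsingleton, (P.isoExt (n + 1) Y).isZero_iff,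
    ← K.exactAt_iff_isZero_homology,
    K.exactAt_iff' n (n + 1) (n + 2) (by simp) (by simp), ShortComplex.moduleCat_exact_iff]
  refine ⟨fun h ↦ subsingleton_of_forall_eq 0 fun α ↦ ?_, fun h f hf ↦ ?_⟩
  · obtain ⟨f, hf, rfl⟩ := P.extMk_surjective α (n + 2) rfl
    exact (P.extMk_eq_zero_iff f _ rfl hf n rfl).2 (h f hf)
  · exact (P.extMk_eq_zero_iff f (n + 2) rfl hf n rfl).1 (Subsingleton.elim _ _)

/-- Dimension shifting: given `0 → K → F → M → 0` exact with `F` flat, exactness of `K ⊗ Q` in one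
degree gives exactness of `M ⊗ Q` in the next, provided `K ⊗ Q₀ → F ⊗ Q₀` is injective. -/
lemma lTensor_exact_of_shortExact {K F M Q₀ Q₁ Q₂ Q₃ : Type u}
    [AddCommGroup K] [Module R K] [AddCommGroup F] [Module R F] [AddCommGroup M] [Module R M]
    [AddCommGroup Q₀] [Module R Q₀] [AddCommGroup Q₁] [Module R Q₁]
    [AddCommGroup Q₂] [Module R Q₂] [AddCommGroup Q₃] [Module R Q₃] [Module.Flat R F]
    {i : K →ₗ[R] F} {p : F →ₗ[R] M} (hip : Function.Exact i p) (hp : Function.Surjective p)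
    {d₃ : Q₃ →ₗ[R] Q₂} {d₂ : Q₂ →ₗ[R] Q₁} {d₁ : Q₁ →ₗ[R] Q₀}
    (h₃₂ : Function.Exact d₃ d₂) (h₂₁ : Function.Exact d₂ d₁)
    (hi : Function.Injective (i.rTensor Q₀))
    (hK : Function.Exact (d₂.lTensor K) (d₁.lTensor K)) :
    Function.Exact (d₃.lTensor M) (d₂.lTensor M) := by
  have comm {A B X Y : Type u} [AddCommGroup A] [Module R A] [AddCommGroup B] [Module R B]
      [AddCommGroup X] [Module R X] [AddCommGroup Y] [Module R Y]
      (f : A →ₗ[R] B) (g : X →ₗ[R] Y) (x : TensorProduct R A X) :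
      g.lTensor B (f.rTensor X x) = f.rTensor Y (g.lTensor A x) := by
    rw [← LinearMap.comp_apply, LinearMap.lTensor_comp_rTensor, ← LinearMap.rTensor_comp_lTensor,
      LinearMap.comp_apply]
  have hF := Module.Flat.lTensor_exact F h₃₂
  have hF' := Module.Flat.lTensor_exact F h₂₁
  intro x
  constructor
  · intro hx
    obtain ⟨y, rfl⟩ := LinearMap.rTensor_surjective _ hp x
    rw [comm] at hx
    obtain ⟨z, hz⟩ := (rTensor_exact Q₁ hip hp _).1 hx
    have hdz : d₁.lTensor K z = 0 := by
      apply hi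
      rw [← comm, hz, hF'.apply_apply_eq_zero, map_zero]
    obtain ⟨w, rfl⟩ := (hK z).1 hdz
    obtain ⟨v, hv⟩ := (hF (y - i.rTensor _ w)).1 (by rw [map_sub, comm, hz, sub_self])
    refine ⟨p.rTensor _ v, ?_⟩
    rw [comm, hv, map_sub, (rTensor_exact Q₂ hip hp).apply_apply_eq_zero, sub_zero]
  · rintro ⟨y, rfl⟩
    obtain ⟨y, rfl⟩ := LinearMap.rTensor_surjective _ hp y
    rw [comm, comm, hF.apply_apply_eq_zero, map_zero]

/-- For `M` finite over a noetherian ring and `I` injective, `Tor_j(M, Hom(Y,I))` vanishes for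
`j > 0` as soon as `Ext^j(M,Y)` does. -/
lemma torVanishes_hom_injective [IsNoetherianRing R] (Y I : ModuleCat.{u} R) [Module.Injective R I]
    (n : ℕ) (M : ModuleCat.{u} R) [Module.Finite R M]
    (hM : ∀ j, Subsingleton (Abelian.Ext M Y (j + 1))) :
    torVanishes R M (ModuleCat.of R (Y →ₗ[R] I)) (n + 1) := by
  let P := ProjectiveResolution.of (ModuleCat.of R (Y →ₗ[R] I))
  induction n generalizing M with
  | zero =>
    obtain ⟨F, _, _, _, _, p, hp⟩ := Module.exists_finite_presentation R M
    have hS := LinearMap.shortExact_shortComplexKer hp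
    have hπ : Function.Surjective (P.π.f 0).hom := (ModuleCat.epi_iff_surjective _).1 inferInstance
    have hP : Function.Exact (P.complex.d 1 0).hom (P.π.f 0).hom :=
      (ShortComplex.ShortExact.moduleCat_exact_iff_function_exact _).1 P.exact₀
    refine (torVanishes_succ_iff M P 0).2 (lTensor_exact_of_shortExact
      (LinearMap.exact_subtype_ker_map p) hp
      ((ShortComplex.ShortExact.moduleCat_exact_iff_function_exact _).1 (P.exact_succ 0))
      hP (rTensor_hom_injective (I := I) p.ker.subtype fun g ↦ ?_) (lTensor_exact _ hP hπ))
    obtain ⟨x, hx⟩ := Abelian.Ext.contravariant_sequence_exact₁ hS Y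
      (Abelian.Ext.mk₀ (ModuleCat.ofHom g)) (add_comm 1 0) ((hM 0).elim _ _)
    obtain ⟨f, rfl⟩ := (Abelian.Ext.mk₀_bijective _ _).2 x
    rw [Abelian.Ext.mk₀_comp_mk₀] at hx
    exact ⟨f.hom, congrArg ModuleCat.Hom.hom ((Abelian.Ext.mk₀_bijective _ _).1 hx)⟩
  | succ n ih =>
    obtain ⟨F, _, _, _, _, p, hp⟩ := Module.exists_finite_presentation R M
    have hS := LinearMap.shortExact_shortComplexKer hp
    have hproj : Module.Projective R (P.complex.X n) :=
      (IsProjective.iff_projective _).2 (P.projective n)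
    refine (torVanishes_succ_iff M P _).2 (lTensor_exact_of_shortExact
      (LinearMap.exact_subtype_ker_map p) hp
      ((ShortComplex.ShortExact.moduleCat_exact_iff_function_exact _).1 (P.exact_succ (n + 1)))
      ((ShortComplex.ShortExact.moduleCat_exact_iff_function_exact _).1 (P.exact_succ n))
      (Module.Flat.rTensor_preserves_injective_linearMap _ p.ker.injective_subtype)
      ((torVanishes_succ_iff (ModuleCat.of R p.ker) P n).1 (ih _ fun j ↦ ?_)))
    have : Projective (ModuleCat.of R F) := (IsProjective.iff_projective _).1 inferInstance
    refine subsingleton_of_forall_eq 0 fun x ↦ ?_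
    obtain ⟨y, rfl⟩ := Abelian.Ext.contravariant_sequence_exact₁ hS Y x (add_comm 1 (j + 1))
      ((hM (j + 1)).elim _ _)
    rw [Abelian.Ext.eq_zero_of_projective y, Abelian.Ext.comp_zero]

/-- `Tor_j(M, -)` vanishing is invariant under isomorphism. -/
lemma torVanishes_of_iso {M V W : ModuleCat.{u} R} (e : V ≅ W) {j : ℕ}
    (h : torVanishes R M W j) : torVanishes R M V j := by
  rw [torVanishes, ← ModuleCat.isZero_iff_subsingleton] at h ⊢
  exact h.of_iso (((Tor (ModuleCat.{u} R) j).obj M).mapIso e)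

lemma extVanishes_of_injective (M I : ModuleCat.{u} R) [Module.Injective R I] (n : ℕ) :
    extVanishes R M I (n + 1) := by
  have : Injective I := Module.injective_object_of_injective_module R I
  exact (extVanishes_succ_iff M I n).2 (Abelian.Ext.subsingleton_of_injective M I n)

end Derived

/-- Bijectivity of `η` is invariant under isomorphism. -/
lemma etaMap_bijective_of_linearEquiv {R : Type u} [CommRing R] {C V W : Type u}
    [AddCommGroup C] [Module R C] [AddCommGroup V] [Module R V] [AddCommGroup W] [Module R W]
    (e : V ≃ₗ[R] W) (h : Function.Bijective (etaMap R C W)) :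
    Function.Bijective (etaMap R C V) := by
  let e' : (C →ₗ[R] TensorProduct R C V) ≃ₗ[R] (C →ₗ[R] TensorProduct R C W) :=
    (LinearEquiv.refl R C).arrowCongr (e.lTensor C)
  have : e' ∘ etaMap R C V = etaMap R C W ∘ e := by
    ext v c
    simp [e', etaMap]
  rw [← e'.bijective.of_comp_iff', this]
  exact h.comp e.bijective

/-- An `R`-module `U` belongs to `I_C` if and only if `U` belongs to the Auslander class
`A_C` and `C ⊗_R U` is an injective `R`-module. -/
theorem mem_IC_iff
    (R : Type u) [CommRing R] [IsNoetherianRing R]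
    (C : Type u) [AddCommGroup C] [Module R C] (hC : IsSemidualizing R C)
    (U : ModuleCat.{u} R) :
    memIC R C U ↔ memAuslander R C U ∧ Module.Injective R (TensorProduct R C U) := by
  obtain ⟨hfin, hext, hhom⟩ := hC
  constructor
  · rintro ⟨I, hI, ⟨e⟩⟩
    have heps : Function.Bijective (epsMap R C I) := epsMap_bijective hhom
    have hinj : Module.Injective R (TensorProduct R C U) :=
      (Module.Baer.of_equiv (e.lTensor C ≪≫ₗ LinearEquiv.ofBijective _ heps).symm
        (Module.Baer.of_injective hI)).injective
    refine ⟨⟨fun j hj ↦ ?_, fun j hj ↦ ?_,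
      etaMap_bijective_of_linearEquiv e (etaMap_hom_bijective heps)⟩, hinj⟩
    · obtain ⟨j, rfl⟩ := Nat.exists_eq_succ_of_ne_zero hj.ne'
      exact torVanishes_of_iso (e.toModuleIso (X₁ := U))
        (torVanishes_hom_injective (ModuleCat.of R C) I j (ModuleCat.of R C)
          fun k ↦ (extVanishes_succ_iff _ _ k).1 (hext _ k.succ_pos))
    · obtain ⟨j, rfl⟩ := Nat.exists_eq_succ_of_ne_zero hj.ne'
      exact extVanishes_of_injective _ (ModuleCat.of R (TensorProduct R C U)) j
  · rintro ⟨⟨-, -, heta⟩, hinj⟩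
    exact ⟨ModuleCat.of R (TensorProduct R C U), hinj, ⟨LinearEquiv.ofBijective _ heta⟩⟩
end

section
/- Let R be a ring and let λ be an infinite cardinal with λ ≥ |R|. If S ⊆ E are R-modules with |S| ≤ λ, then there exists a pure submodule T of E with S ⊆ T and |T| ≤ λ. -/
universe u

open Cardinal in
theorem Cardinal.mk_sigma_nat_le {lam : Cardinal.{u}} (hlam : ℵ₀ ≤ lam) (F : ℕ → Type u)
    (hF : ∀ n, #(F n) ≤ lam) : #(Σ n, F n) ≤ lam := by
  rw [mk_sigma]
  calc sum (fun n => #(F n)) ≤ sum (fun _ : ℕ => lam) := sum_le_sum _ _ hF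
    _ = ℵ₀ * lam := by simp
    _ = lam := aleph0_mul_eq hlam

open Cardinal in
theorem Cardinal.mk_fin_fun_le {lam : Cardinal.{u}} (hlam : ℵ₀ ≤ lam) (n : ℕ) (A : Type u)
    (hA : #A ≤ lam) : #(Fin n → A) ≤ lam := by
  have h : #(Fin n → A) = #A ^ n := by simp
  rw [h]
  exact (pow_le_pow_left' hA n).trans (power_nat_le hlam)

open Cardinal in
/-- A subset of cardinality at most `lam` is contained in a subset of cardinality at most `lam`
that is closed under a given family of at most `lam` finitary operations. -/
theorem Set.exists_closed_superset_mk_le {E : Type u} {F : ℕ → Type u}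
    (op : ∀ {n}, F n → (Fin n → E) → E) {lam : Cardinal.{u}} (hlam : ℵ₀ ≤ lam)
    (hF : ∀ n, #(F n) ≤ lam) (s : Set E) (hs : #s ≤ lam) :
    ∃ t : Set E, s ⊆ t ∧ #t ≤ lam ∧
      ∀ {n} (f : F n) (x : Fin n → E), (∀ i, x i ∈ t) → op f x ∈ t := by
  let L : FirstOrder.Language.{u, 0} := ⟨F, fun _ => Empty⟩
  let _ : L.Structure E := ⟨fun f x => op f x, fun r => r.elim⟩
  refine ⟨FirstOrder.Language.Substructure.closure L s,
    FirstOrder.Language.Substructure.subset_closure, ?_,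
    fun f x hx => FirstOrder.Language.Substructure.fun_mem (L := L) _ f x hx⟩
  have h := FirstOrder.Language.Substructure.lift_card_closure_le (L := L) (s := s)
  simp only [lift_id] at h
  exact h.trans (max_le hlam (add_le_of_le hlam hs (mk_sigma_nat_le hlam F hF)))

open TensorProduct in
theorem TensorProduct.exists_eq_sum_tmul_of_span_eq_top {R M N ι : Type*} [CommRing R]
    [AddCommGroup M] [Module R M] [AddCommGroup N] [Module R N] [Fintype ι] {g : ι → M}
    (hg : Submodule.span R (Set.range g) = ⊤) (w : M ⊗[R] N) :
    ∃ x : ι → N, w = ∑ i, g i ⊗ₜ x i := by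
  induction w with
  | zero => exact ⟨0, by simp⟩
  | tmul m n =>
    obtain ⟨c, rfl⟩ := (Submodule.mem_span_range_iff_exists_fun R).mp
      (hg ▸ Submodule.mem_top : m ∈ Submodule.span R (Set.range g))
    exact ⟨fun i => c i • n, by simp [sum_tmul, smul_tmul]⟩
  | add v w hv hw =>
    obtain ⟨x, rfl⟩ := hv
    obtain ⟨y, rfl⟩ := hw
    exact ⟨x + y, by simp [tmul_add, Finset.sum_add_distrib]⟩

open TensorProduct in
/-- For a fixed linear map `f`, if all maps `P ⊗ f` with `P` finitely generated in `N` are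
injective, then so is `N ⊗ f`. -/
theorem LinearMap.lTensor_injective_of_forall_fg {R M M' N : Type*} [CommRing R]
    [AddCommGroup M] [Module R M] [AddCommGroup M'] [Module R M'] [AddCommGroup N] [Module R N]
    (f : M →ₗ[R] M')
    (hf : ∀ P : Submodule R N, P.FG → Function.Injective (f.lTensor P)) :
    Function.Injective (f.lTensor N) := by
  refine (injective_iff_map_eq_zero _).mpr fun w hw => ?_
  obtain ⟨P, hP, v, rfl⟩ := TensorProduct.exists_of_fg w
  have hv : P.subtype.rTensor M' (f.lTensor P v) = 0 := by
    rw [← hw, ← LinearMap.comp_apply, ← LinearMap.comp_apply, LinearMap.rTensor_comp_lTensor,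
      LinearMap.lTensor_comp_rTensor]
  obtain ⟨Q, hPQ, hQ, h⟩ := TensorProduct.eq_zero_of_fg_of_subtype_eq_zero hP hv
  rw [← LinearMap.comp_apply, LinearMap.rTensor_comp_lTensor, ← LinearMap.lTensor_comp_rTensor,
    LinearMap.comp_apply] at h
  have h' := (injective_iff_map_eq_zero _).mp (hf Q hQ) _ h
  rw [← Submodule.subtype_comp_inclusion P Q hPQ, LinearMap.rTensor_comp, LinearMap.comp_apply,
    h', map_zero]

/-- A submodule in which every finite linear system solvable in the ambient module is solvable
is pure. -/
theorem Submodule.lTensor_subtype_injective_of_solvable {R E : Type*} [CommRing R]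
    [AddCommGroup E] [Module R E] (T : Submodule R E)
    (hT : ∀ (n k : ℕ) (a : Fin n → Fin k → R) (x : Fin n → T) (y : Fin k → E),
      (∀ i, (x i : E) = ∑ j, a i j • y j) → ∃ z : Fin k → T, ∀ i, x i = ∑ j, a i j • z j)
    (N : Type*) [AddCommGroup N] [Module R N] :
    Function.Injective (LinearMap.lTensor N T.subtype) := by
  refine LinearMap.lTensor_injective_of_forall_fg _ fun P hP => ?_
  have : Module.Finite R P := Module.Finite.iff_fg.mpr hP
  obtain ⟨n, g, hg⟩ := Module.Finite.exists_fin (R := R) (M := P)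
  refine (injective_iff_map_eq_zero _).mpr fun w hw => ?_
  obtain ⟨x, rfl⟩ := TensorProduct.exists_eq_sum_tmul_of_span_eq_top hg w
  simp only [map_sum, LinearMap.lTensor_tmul, Submodule.subtype_apply] at hw
  obtain ⟨k, a, y, hy, ha⟩ := TensorProduct.vanishesTrivially_of_sum_tmul_eq_zero R hg hw
  obtain ⟨z, hz⟩ := hT n k a x y hy
  exact TensorProduct.sum_tmul_eq_zero_of_vanishesTrivially R ⟨k, a, z, hz, ha⟩

/-- Operations on a module indexed by coefficient families (linear combinations) or by finite
linear systems together with an unknown (a chosen solution, for a given right-hand side). -/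
noncomputable def solutionOp {R E : Type*} [CommRing R] [AddCommGroup E] [Module R E] {n : ℕ} :
    (Fin n → R) ⊕ (Σ k : ℕ, (Fin n → Fin k → R) × Fin k) → (Fin n → E) → E
  | .inl c, x => ∑ i, c i • x i
  | .inr ⟨k, a, j⟩, x =>
    open Classical in
    if h : ∃ y : Fin k → E, ∀ i, x i = ∑ j, a i j • y j then h.choose j else 0

theorem eq_sum_smul_solutionOp {R E : Type*} [CommRing R] [AddCommGroup E] [Module R E] {n k : ℕ}
    (a : Fin n → Fin k → R) (x : Fin n → E)
    (h : ∃ y : Fin k → E, ∀ i, x i = ∑ j, a i j • y j) (i : Fin n) :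
    x i = ∑ j, a i j • solutionOp (.inr ⟨k, a, j⟩) x := by
  simp only [solutionOp, dif_pos h]
  exact h.choose_spec i

/-- Let `λ ≥ |R|` be an infinite cardinal.  If `S ⊆ E` are `R`-modules with `|S| ≤ λ`,
then there is a pure submodule `T ⊆ E` (i.e. `N ⊗ T → N ⊗ E` is injective for every
module `N`) with `S ⊆ T` and `|T| ≤ λ`. -/
theorem exists_pure_submodule
    (R : Type u) [CommRing R]
    (lam : Cardinal.{u}) (hlam : Cardinal.aleph0 ≤ lam) (hR : Cardinal.mk R ≤ lam)
    (E : Type u) [AddCommGroup E] [Module R E]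
    (S : Submodule R E) (hS : Cardinal.mk S ≤ lam) :
    ∃ T : Submodule R E, S ≤ T ∧ Cardinal.mk T ≤ lam ∧
      ∀ (N : Type u) [AddCommGroup N] [Module R N],
        Function.Injective (LinearMap.lTensor N T.subtype) := by
  have hF (n : ℕ) : Cardinal.mk
      ((Fin n → R) ⊕ (Σ k : ℕ, (Fin n → Fin k → R) × Fin k)) ≤ lam := by
    rw [← Cardinal.add_def]
    refine Cardinal.add_le_of_le hlam (Cardinal.mk_fin_fun_le hlam n R hR)
      (Cardinal.mk_sigma_nat_le hlam _ fun k => ?_)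
    rw [Cardinal.mk_prod, Cardinal.lift_id'.{0, u}]
    refine Cardinal.mul_le_of_le hlam
      (Cardinal.mk_fin_fun_le hlam n _ (Cardinal.mk_fin_fun_le hlam k R hR)) ?_
    simpa using (Cardinal.natCast_lt_aleph0 (n := k)).le.trans hlam
  obtain ⟨t, hSt, ht, hop⟩ := Set.exists_closed_superset_mk_le (solutionOp (R := R)) hlam hF
    (S : Set E) hS
  obtain ⟨T, rfl⟩ : ∃ T : Submodule R E, (T : Set E) = t := ⟨
    { carrier := t
      zero_mem' := hSt S.zero_mem
      add_mem' := fun {x y} hx hy => by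
        simpa [solutionOp] using hop (n := 2) (.inl fun _ => (1 : R)) ![x, y] (by simp_all)
      smul_mem' := fun c x hx => by
        simpa [solutionOp] using hop (n := 1) (.inl fun _ => c) ![x] (by simp_all) }, rfl⟩
  refine ⟨T, hSt, ht, T.lTensor_subtype_injective_of_solvable fun n k a x y hy => ?_⟩
  refine ⟨fun j => ⟨_, hop (.inr ⟨k, a, j⟩) (fun i => (x i : E)) fun i => (x i).2⟩,
    fun i => Subtype.ext ?_⟩
  rw [eq_sum_smul_solutionOp a (fun i => (x i : E)) ⟨y, hy⟩ i, Submodule.coe_sum]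
  rfl
end
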